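/- Let n be an odd prime and let H be a finitely generated subgroup of SL(n,ℤ). Then φ_p(H) = SL(n,ℤ/pℤ) for all but finitely many primes p if and only if H contains an element whose characteristic polynomial is irreducible over ℚ and H is not solvable-by-finite. -/

import Mathlib

open Matrix

/-- `SL n R` : the special linear group of `n × n` matrices over `R`. -/
abbrev SL (n : ℕ) (R : Type*) [CommRing R] := Matrix.SpecialLinearGroup (Fin n) R

/-- The reduction-mod-`p` homomorphism `φ_p : SL(n,ℤ) → SL(n,ℤ/pℤ)`. -/
def redMod (n p : ℕ) : SL n ℤ →* SL n (ZMod p) :=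
  Matrix.SpecialLinearGroup.map (Int.castRingHom (ZMod p))

/-- The rational matrix underlying an element of `SL(n,ℤ)`. -/
def matQ {n : ℕ} (g : SL n ℤ) : Matrix (Fin n) (Fin n) ℚ :=
  (g : Matrix (Fin n) (Fin n) ℤ).map ((↑) : ℤ → ℚ)

/-- A subgroup of `SL(n,ℤ)` is absolutely irreducible over `ℚ` if its elements generate the
full matrix algebra over `ℚ`. -/
def AbsIrredQ {n : ℕ} (H : Subgroup (SL n ℤ)) : Prop :=
  Algebra.adjoin ℚ (matQ '' (H : Set (SL n ℤ))) = ⊤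

/-- A subgroup of `SL(n, ℤ/pℤ)` is absolutely irreducible if its elements generate the
full matrix algebra over `ℤ/pℤ`. -/
def AbsIrredMod {n p : ℕ} (G : Subgroup (SL n (ZMod p))) : Prop :=
  Algebra.adjoin (ZMod p)
    ((fun g : SL n (ZMod p) => (g : Matrix (Fin n) (Fin n) (ZMod p))) '' (G : Set _)) = ⊤

/-- Irreducibility of the natural action of a subgroup of `SL(n,R)` on `R^n`. -/
def IrreducibleSub (R : Type*) [CommRing R] {n : ℕ} (G : Subgroup (SL n R)) : Prop :=
  ∀ W : Submodule R (Fin n → R),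
    (∀ g ∈ G, W.map (Matrix.toLin' (g : Matrix (Fin n) (Fin n) R)) ≤ W) → W = ⊥ ∨ W = ⊤

/-- Imprimitivity: a nontrivial direct-sum decomposition whose summands are permuted by `G`. -/
def ImprimitiveSub (R : Type*) [CommRing R] {n : ℕ} (G : Subgroup (SL n R)) : Prop :=
  ∃ m : ℕ, 2 ≤ m ∧ ∃ W : Fin m → Submodule R (Fin n → R),
    (∀ i, W i ≠ ⊥) ∧ DirectSum.IsInternal W ∧
    ∀ g ∈ G, ∀ i, ∃ j, (W i).map (Matrix.toLin' (g : Matrix (Fin n) (Fin n) R)) = W j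

/-- Primitivity: irreducible and not imprimitive. -/
def PrimitiveSub (R : Type*) [CommRing R] {n : ℕ} (G : Subgroup (SL n R)) : Prop :=
  IrreducibleSub R G ∧ ¬ ImprimitiveSub R G

/-- Monomiality: a direct sum of `n` one-dimensional subspaces permuted by `G`. -/
def MonomialSub (R : Type*) [CommRing R] {n : ℕ} (G : Subgroup (SL n R)) : Prop :=
  ∃ L : Fin n → Submodule R (Fin n → R),
    (∀ i, Module.finrank R (L i) = 1) ∧ DirectSum.IsInternal L ∧
    ∀ g ∈ G, ∀ i, ∃ j, (L i).map (Matrix.toLin' (g : Matrix (Fin n) (Fin n) R)) = L j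

/-- Irreducibility of a subgroup of `SL(n,ℤ)` acting on `ℚ^n`. -/
def IrreducibleQ {n : ℕ} (H : Subgroup (SL n ℤ)) : Prop :=
  ∀ W : Submodule ℚ (Fin n → ℚ),
    (∀ g ∈ H, W.map (Matrix.toLin' (matQ g)) ≤ W) → W = ⊥ ∨ W = ⊤

/-- Imprimitivity of a subgroup of `SL(n,ℤ)` acting on `ℚ^n`. -/
def ImprimitiveQ {n : ℕ} (H : Subgroup (SL n ℤ)) : Prop :=
  ∃ m : ℕ, 2 ≤ m ∧ ∃ W : Fin m → Submodule ℚ (Fin n → ℚ),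
    (∀ i, W i ≠ ⊥) ∧ DirectSum.IsInternal W ∧
    ∀ g ∈ H, ∀ i, ∃ j, (W i).map (Matrix.toLin' (matQ g)) = W j

/-- Primitivity of a subgroup of `SL(n,ℤ)` acting on `ℚ^n`. -/
def PrimitiveQ {n : ℕ} (H : Subgroup (SL n ℤ)) : Prop :=
  IrreducibleQ H ∧ ¬ ImprimitiveQ H

/-- A group is solvable-by-finite if it has a solvable subgroup of finite index. -/
def SolvableByFinite (G : Type*) [Group G] : Prop :=
  ∃ K : Subgroup G, IsSolvable K ∧ K.FiniteIndex

/-- A subgroup of `SL(n,ℤ)` is an isometry group if it preserves a nondegenerate bilinear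
form on `ℚ^n`. -/
def IsometryGroupQ {n : ℕ} (H : Subgroup (SL n ℤ)) : Prop :=
  ∃ Φ : Matrix (Fin n) (Fin n) ℚ, IsUnit Φ ∧ ∀ h ∈ H, matQ h * Φ * (matQ h)ᵀ = Φ

section PartA

theorem auxA_diag2 {n : ℕ} {F : Type*} [Field F] (G : Subgroup (SL n F))
    (hG : ∀ (i j : Fin n) (hij : i ≠ j) (b : F),
      Matrix.SpecialLinearGroup.transvection hij b ∈ G) (i j : Fin n) (hij : i ≠ j) (a : F)
    (ha : a ≠ 0) (M : SL n F)
    (hM : M.1 = Matrix.diagonal (fun k => if k = i then a else if k = j then a⁻¹ else 1)) :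
    M ∈ G := by
  have key : M = Matrix.SpecialLinearGroup.transvection hij a *
      Matrix.SpecialLinearGroup.transvection hij.symm (-a⁻¹) *
      Matrix.SpecialLinearGroup.transvection hij a *
      (Matrix.SpecialLinearGroup.transvection hij (-1) *
      Matrix.SpecialLinearGroup.transvection hij.symm (1) *
      Matrix.SpecialLinearGroup.transvection hij (-1)) := by
    apply Subtype.ext
    rw [hM]
    simp only [Matrix.SpecialLinearGroup.coe_mul, Matrix.SpecialLinearGroup.transvection_coe]
    have hd : Matrix.diagonal (fun k => if k = i then a else if k = j then a⁻¹ else 1)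
      = (1 : Matrix (Fin n) (Fin n) F) + Matrix.single i i (a - 1)
        + Matrix.single j j (a⁻¹ - 1) := by
      ext k l
      by_cases hkl : k = l
      · subst hkl
        by_cases h1 : k = i
        · subst h1
          simp [Matrix.single_apply, hij.symm]
        · by_cases h2 : k = j
          · subst h2; simp [hij, h1]
          · simp [Matrix.single_apply, h1, h2, Ne.symm h1, Ne.symm h2]
      · simp [Matrix.single_apply, hkl]
        grind
    rw [hd]
    simp only [mul_add, add_mul, one_mul, mul_one, Matrix.single_mul_single_same,
      Matrix.single_mul_single_of_ne _ _ _ _ hij, Matrix.single_mul_single_of_ne _ _ _ _ hij.symm,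
      ne_eq, hij, hij.symm, not_false_eq_true, mul_zero, zero_mul, add_zero, zero_add]
    ext k l
    simp only [Matrix.add_apply, Matrix.single_apply, Matrix.one_apply]
    by_cases h1 : k = i <;> by_cases h2 : l = i <;> by_cases h3 : k = j <;>
      by_cases h4 : l = j <;> grind
  rw [key]
  exact mul_mem (mul_mem (mul_mem (hG _ _ _ _) (hG _ _ _ _)) (hG _ _ _ _))
    (mul_mem (mul_mem (hG _ _ _ _) (hG _ _ _ _)) (hG _ _ _ _))

theorem auxA_diag {n : ℕ} {F : Type*} [Field F] (G : Subgroup (SL n F))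
    (hG : ∀ (i j : Fin n) (hij : i ≠ j) (b : F),
      Matrix.SpecialLinearGroup.transvection hij b ∈ G) (i0 : Fin n) (D : Fin n → F)
    (hD : ∀ i, D i ≠ 0) (s : Finset (Fin n)) (hs : i0 ∉ s) :
    ∀ M : SL n F, M.1 = Matrix.diagonal
      (fun k => if k ∈ s then D k else if k = i0 then (∏ i ∈ s, D i)⁻¹ else 1) → M ∈ G := by
  induction s using Finset.induction_on with
  | empty =>
    intro M hM
    have : M = 1 := by
      apply Subtype.ext
      rw [hM]
      ext k l
      simp [Matrix.diagonal, Matrix.one_apply]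
    rw [this]; exact one_mem _
  | insert a s has ih =>
    intro M hM
    have hai : a ≠ i0 := by rintro rfl; simp at hs
    have hs' : i0 ∉ s := by intro h; apply hs; simp [h]
    have hp : ∏ i ∈ s, D i ≠ 0 := Finset.prod_ne_zero_iff.2 (fun i _ => hD i)
    let f2 : Fin n → F := fun k => if k = a then D a else if k = i0 then (D a)⁻¹ else 1
    have hf2 : (Matrix.diagonal f2).det = 1 := by
      rw [Matrix.det_diagonal]
      rw [← Finset.mul_prod_erase _ _ (Finset.mem_univ a),
        ← Finset.mul_prod_erase _ _ (Finset.mem_erase.2 ⟨hai.symm, Finset.mem_univ i0⟩)]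
      rw [Finset.prod_eq_one]
      · simp [f2, hai.symm, hD a]
      · intro x hx
        simp at hx
        simp [f2, hx.1, hx.2]
    let M2 : SL n F := ⟨Matrix.diagonal f2, hf2⟩
    have hM2 : M2 ∈ G := auxA_diag2 G hG a i0 hai (D a) (hD a) M2 rfl
    have hMM : (M * M2⁻¹) ∈ G := by
      apply ih hs'
      have h3 : (M * M2⁻¹).1 * M2.1 = M.1 := by
        rw [← Matrix.SpecialLinearGroup.coe_mul]; simp
      have h4 : Matrix.diagonal
        (fun k => if k ∈ s then D k else if k = i0 then (∏ i ∈ s, D i)⁻¹ else 1) * M2.1 = M.1 := by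
        rw [hM]
        change _ * Matrix.diagonal f2 = _
        rw [Matrix.diagonal_mul_diagonal]
        congr 1
        ext k
        simp only [f2, Finset.mem_insert, Finset.prod_insert has, mul_inv]
        by_cases h1 : k = a
        · subst h1; simp [has, hai]
        · by_cases h2 : k = i0
          · subst h2; simp [hs', h1, mul_comm]
          · simp [h1, h2]
      have h5 : M2.1 * (M2⁻¹).1 = 1 := by
        rw [← Matrix.SpecialLinearGroup.coe_mul]; simp
      have := congrArg (· * (M2⁻¹).1) (h3.trans h4.symm)
      simp only [Matrix.mul_assoc, h5, Matrix.mul_one] at this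
      exact this
    have := mul_mem hMM hM2
    simpa using this

theorem auxA_top {n : ℕ} {F : Type*} [Field F] (hn : 0 < n) (G : Subgroup (SL n F))
    (hG : ∀ (i j : Fin n) (hij : i ≠ j) (b : F),
      Matrix.SpecialLinearGroup.transvection hij b ∈ G) : G = ⊤ := by
  rw [eq_top_iff]
  intro M _
  obtain ⟨L, L', D, h⟩ := Matrix.Pivot.exists_list_transvec_mul_diagonal_mul_list_transvec M.1
  have hL : ∀ L : List (Matrix.TransvectionStruct (Fin n) F), ∃ g ∈ G,
      g.1 = (L.map Matrix.TransvectionStruct.toMatrix).prod := by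
    intro L
    induction L with
    | nil => exact ⟨1, one_mem _, by simp⟩
    | cons t L ih =>
      obtain ⟨g, hg, hg2⟩ := ih
      refine ⟨Matrix.SpecialLinearGroup.transvection t.hij t.c * g, mul_mem (hG _ _ _ _) hg, ?_⟩
      simp [hg2, Matrix.SpecialLinearGroup.transvection_coe, Matrix.TransvectionStruct.toMatrix,
        Matrix.transvection]
  obtain ⟨g, hg, hg2⟩ := hL L
  obtain ⟨g', hg', hg2'⟩ := hL L'
  rw [← hg2, ← hg2'] at h
  have hdet : (Matrix.diagonal D).det = 1 := by
    have := congrArg Matrix.det h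
    simpa using this.symm
  have hprod : ∏ i, D i = 1 := by simpa using hdet
  have hDi : ∀ i, D i ≠ 0 := by
    intro i hi
    rw [Finset.prod_eq_zero (Finset.mem_univ i) hi] at hprod
    exact zero_ne_one hprod
  have hd : (⟨Matrix.diagonal D, hdet⟩ : SL n F) ∈ G := by
    apply auxA_diag G hG ⟨0, hn⟩ D hDi (Finset.univ.erase ⟨0, hn⟩) (by simp)
    change Matrix.diagonal D = _
    congr 1
    ext k
    by_cases hk : k = ⟨0, hn⟩
    · subst hk
      simp
      rw [← Finset.mul_prod_erase _ _ (Finset.mem_univ (⟨0, hn⟩ : Fin n))] at hprod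
      exact eq_inv_of_mul_eq_one_left hprod
    · simp [hk]
  have : M = g * ⟨Matrix.diagonal D, hdet⟩ * g' := Subtype.ext h
  rw [this]
  exact mul_mem (mul_mem hg hd) hg'

theorem auxA_transvection_pow {n : ℕ} {F : Type*} [Field F] {i j : Fin n} (hij : i ≠ j) (b : F)
    (k : ℕ) : (Matrix.SpecialLinearGroup.transvection hij b) ^ k
      = Matrix.SpecialLinearGroup.transvection hij (k * b) := by
  induction k with
  | zero => simp
  | succ k ih =>
    rw [pow_succ, ih]
    apply Subtype.ext
    have := Matrix.transvection_mul_transvection_same (i := i) (j := j) hij (k * b) b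
    simp only [Matrix.transvection] at this
    rw [Matrix.SpecialLinearGroup.coe_mul]
    simp only [Matrix.SpecialLinearGroup.transvection_coe]
    rw [this]
    push_cast
    ring_nf

/-- If `x` has order dividing a prime `p` and `N` has some positive power `x^k`, `k < p`
then it contains `x`. -/
theorem auxA_mem_of_pow {G : Type*} [Group G] (N : Subgroup G) (p : ℕ) (hp : p.Prime) (x : G)
    (hx : x ^ p = 1) (k : ℕ) (hk : k.Coprime p) (hxk : x ^ k ∈ N) : x ∈ N := by
  have h1 : x ^ (Nat.gcd k p) ∈ N := by
    have h2 : (x : G) ^ ((Nat.gcd k p : ℕ) : ℤ) = x ^ ((k : ℤ) * Nat.gcdA k p + p * Nat.gcdB k p) := by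
      rw [Nat.gcd_eq_gcd_ab]
    rw [_root_.zpow_natCast] at h2
    rw [h2, _root_.zpow_add, _root_.zpow_mul, _root_.zpow_mul, _root_.zpow_natCast, _root_.zpow_natCast, hx]
    simpa using N.zpow_mem hxk _
  rw [hk] at h1
  simpa using h1

theorem auxA_index {n p : ℕ} (hn : 0 < n) (hp : p.Prime) (G : Subgroup (SL n (ZMod p)))
    (hG0 : G.index ≠ 0) (hGp : G.index < p) : G = ⊤ := by
  haveI := Fact.mk hp
  apply auxA_top hn
  intro i j hij b
  obtain ⟨k, hk0, hk, hkm⟩ := Subgroup.exists_pow_mem_of_index_ne_zero hG0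
    (Matrix.SpecialLinearGroup.transvection hij b)
  refine auxA_mem_of_pow G p hp _ ?_ k ?_ hkm
  · rw [auxA_transvection_pow]; simp
  · rw [Nat.coprime_comm, hp.coprime_iff_not_dvd]
    intro h
    have := Nat.le_of_dvd hk0 h
    omega

end PartA


section PartB

theorem auxB_exists_irred (n p : ℕ) (hn : n.Prime) (hp : p.Prime) :
    ∃ g : SL n (ZMod p), Irreducible g.1.charpoly := by
  have := Fact.mk hp
  let K := ZMod p
  let F := GaloisField p n
  have hfr : Module.finrank K F = n := GaloisField.finrank p hn.ne_zero
  have hcard : Nat.card F = p ^ n := GaloisField.card p n hn.ne_zero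
  have : Finite F := Nat.finite_of_card_ne_zero (by rw [hcard]; exact pow_ne_zero _ hp.ne_zero)
  have : Fintype F := Fintype.ofFinite F
  have hsimple : IsSimpleOrder (Subalgebra K F) :=
    Subalgebra.isSimpleOrder_of_finrank_prime K F (by rw [hfr]; exact hn)
  obtain ⟨b, hb0, hb⟩ : ∃ b : F, b ≠ 0 ∧ b ^ (p - 1) ∉ (⊥ : Subalgebra K F) := by
    by_contra hcon
    push Not at hcon
    have hp1 : 0 < p - 1 := by have := hp.two_le; omega
    have h1 : ∀ b : F, b ≠ 0 → b ^ ((p - 1) * (p - 1)) = 1 := by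
      intro b hb
      have := hcon b hb
      rw [Algebra.mem_bot] at this
      obtain ⟨c, hc⟩ := this
      have hc0 : c ≠ 0 := by
        rintro rfl
        rw [map_zero] at hc
        exact pow_ne_zero _ hb hc.symm
      rw [pow_mul, ← hc, ← map_pow, ZMod.pow_card_sub_one_eq_one hc0, map_one]
    have h2 : Fintype.card F - 1 ≤ (p - 1) * (p - 1) := by
      have := Polynomial.card_nthRoots (R := F) ((p - 1) * (p - 1)) 1
      classical
      refine le_trans ?_ this
      have hsub : (Finset.univ.erase (0 : F)) ⊆
          (Polynomial.nthRoots ((p - 1) * (p - 1)) (1 : F)).toFinset := by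
        intro b hb
        simp at hb
        simp only [Multiset.mem_toFinset]
        rw [Polynomial.mem_nthRoots (by positivity)]
        exact h1 b hb
      have := Finset.card_le_card hsub
      rw [Finset.card_erase_of_mem (Finset.mem_univ _), Finset.card_univ] at this
      exact this.trans (Multiset.toFinset_card_le _)
    rw [← Nat.card_eq_fintype_card, hcard] at h2
    have h3 : p ^ 2 ≤ p ^ n := Nat.pow_le_pow_right hp.pos hn.two_le
    obtain ⟨q, rfl⟩ : ∃ q, p = q + 2 := ⟨p - 2, by have := hp.two_le; omega⟩
    have h4 : (q + 2) ^ n ≤ (q + 1) * (q + 1) + 1 := by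
      have : q + 2 - 1 = q + 1 := by omega
      rw [this] at h2
      omega
    nlinarith
  set a := b ^ (p - 1) with ha
  have htop : Algebra.adjoin K {a} = ⊤ := by
    rcases hsimple.eq_bot_or_eq_top (Algebra.adjoin K {a}) with h | h
    · exfalso
      apply hb
      rw [← h]
      exact Algebra.subset_adjoin rfl
    · exact h
  have hIntegral : IsIntegral K a := Algebra.IsIntegral.isIntegral a
  let pb := PowerBasis.ofAdjoinEqTop hIntegral htop
  have hgen : pb.gen = a := PowerBasis.ofAdjoinEqTop_gen hIntegral htop
  have hdim : pb.dim = n := by rw [← pb.finrank, hfr]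
  let B := pb.basis.reindex (finCongr hdim)
  have hdet : (Algebra.leftMulMatrix B a).det = 1 := by
    rw [← Algebra.norm_eq_matrix_det, ha, map_pow]
    apply ZMod.pow_card_sub_one_eq_one
    exact (Algebra.norm_ne_zero_iff).2 hb0
  refine ⟨⟨_, hdet⟩, ?_⟩
  have h5 : (Algebra.leftMulMatrix B a).charpoly = minpoly K a := by
    rw [← hgen, ← charpoly_leftMulMatrix pb]
    have : Algebra.leftMulMatrix B pb.gen = Matrix.reindex (finCongr hdim) (finCongr hdim)
        (Algebra.leftMulMatrix pb.basis pb.gen) := by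
      ext i j
      simp [B, Algebra.leftMulMatrix_eq_repr_mul]
    rw [this, Matrix.charpoly_reindex]
  change Irreducible (Algebra.leftMulMatrix B a).charpoly
  rw [h5]
  exact minpoly.irreducible hIntegral

theorem auxB_irred_lift (n p : ℕ) (hp : p.Prime) (h : SL n ℤ)
    (hirr : Irreducible (redMod n p h).1.charpoly) : Irreducible (matQ h).charpoly := by
  have := Fact.mk hp
  have h1 : (redMod n p h).1.charpoly = h.1.charpoly.map (Int.castRingHom (ZMod p)) := by
    rw [← Matrix.charpoly_map]; rfl
  have h2 : (matQ h).charpoly = h.1.charpoly.map (algebraMap ℤ ℚ) := by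
    rw [← Matrix.charpoly_map]; rfl
  rw [h2, ← Polynomial.Monic.irreducible_iff_irreducible_map_fraction_map
    (Matrix.charpoly_monic _)]
  rw [h1] at hirr
  exact Polynomial.Monic.irreducible_of_irreducible_map _ _ (Matrix.charpoly_monic _) hirr

open scoped commutatorElement in
theorem auxB_perfect (n : ℕ) (hn : 3 ≤ n) (F : Type*) [Field F] :
    ¬ Group.IsSolvable (SL n F) := by
  intro hs
  have hnt : Nontrivial (SL n F) := by
    refine ⟨Matrix.SpecialLinearGroup.transvection
      (i := (⟨0, by omega⟩ : Fin n)) (j := ⟨1, by omega⟩) (by simp) 1, 1, ?_⟩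
    intro h
    have := congrArg (fun M : SL n F => M.1 ⟨0, by omega⟩ ⟨1, by omega⟩) h
    simp [Matrix.SpecialLinearGroup.transvection_coe] at this
  refine (Group.IsSolvable.commutator_lt_top_of_nontrivial (SL n F)).ne ?_
  apply auxA_top (by omega)
  intro i j hij b
  obtain ⟨k, hki, hkj⟩ : ∃ k : Fin n, k ≠ i ∧ k ≠ j := by
    by_contra hcon
    push Not at hcon
    have : (Finset.univ : Finset (Fin n)) ⊆ {i, j} := by
      intro k _
      by_cases hk : k = i
      · simp [hk]
      · simp [hcon k hk]
    have := Finset.card_le_card this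
    have h2 : ({i, j} : Finset (Fin n)).card ≤ 2 := Finset.card_le_two
    simp at this
    omega
  have key : Matrix.SpecialLinearGroup.transvection hij b =
      ⁅Matrix.SpecialLinearGroup.transvection hki.symm b,
        Matrix.SpecialLinearGroup.transvection hkj (1 : F)⁆ := by
    rw [commutatorElement_def, eq_mul_inv_iff_mul_eq, eq_mul_inv_iff_mul_eq]
    apply Subtype.ext
    simp only [Matrix.SpecialLinearGroup.coe_mul, Matrix.SpecialLinearGroup.transvection_coe]
    simp only [mul_add, add_mul, one_mul, mul_one, Matrix.single_mul_single_same,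
      Matrix.single_mul_single_of_ne _ _ _ _ hij, Matrix.single_mul_single_of_ne _ _ _ _ hij.symm,
      Matrix.single_mul_single_of_ne _ _ _ _ hki, Matrix.single_mul_single_of_ne _ _ _ _ hki.symm,
      Matrix.single_mul_single_of_ne _ _ _ _ hkj, Matrix.single_mul_single_of_ne _ _ _ _ hkj.symm,
      add_zero, zero_add]
    abel
  rw [key]
  exact Subgroup.commutator_mem_commutator (Subgroup.mem_top _) (Subgroup.mem_top _)

theorem auxB_forward (n : ℕ) (hn : n.Prime) (hodd : Odd n)
    (H : Subgroup (SL n ℤ))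
    (hfin : {p : ℕ | p.Prime ∧ H.map (redMod n p) ≠ ⊤}.Finite) :
      ((∃ h ∈ H, Irreducible (matQ h).charpoly) ∧ ¬ SolvableByFinite H) := by
  obtain ⟨B, hB⟩ := hfin.bddAbove
  have hgood : ∀ p : ℕ, p.Prime → B < p → H.map (redMod n p) = ⊤ := by
    intro p hp hpB
    by_contra hcon
    have := hB (show p ∈ {p : ℕ | p.Prime ∧ H.map (redMod n p) ≠ ⊤} from ⟨hp, hcon⟩)
    omega
  constructor
  · obtain ⟨p, hpB, hp⟩ := Nat.exists_infinite_primes (B + 1)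
    obtain ⟨g, hg⟩ := auxB_exists_irred n p hn hp
    have : g ∈ H.map (redMod n p) := by rw [hgood p hp hpB]; trivial
    obtain ⟨h, hh, rfl⟩ := this
    exact ⟨h, hh, auxB_irred_lift n p hp h hg⟩
  · rintro ⟨K, hK, hKf⟩
    obtain ⟨p, hpB, hp⟩ := Nat.exists_infinite_primes (B + K.index + 1)
    have := Fact.mk hp
    let f : K →* SL n (ZMod p) := ((redMod n p).comp H.subtype).comp K.subtype
    have hft : f.range = ⊤ := by
      apply auxA_top hn.pos
      intro i j hij b
      have hm : Matrix.SpecialLinearGroup.transvection hij b ∈ H.map (redMod n p) := by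
        rw [hgood p hp (by omega)]; trivial
      obtain ⟨h, hh, hhe⟩ := hm
      obtain ⟨k, hk0, hk, hkm⟩ := Subgroup.exists_pow_mem_of_index_ne_zero hKf.index_ne_zero
        (⟨h, hh⟩ : H)
      refine auxA_mem_of_pow _ p hp _ ?_ k ?_ (?_ : _ ∈ f.range)
      · rw [auxA_transvection_pow]; simp
      · rw [Nat.coprime_comm, hp.coprime_iff_not_dvd]
        intro h
        have := Nat.le_of_dvd hk0 h
        omega
      · refine ⟨⟨_, hkm⟩, ?_⟩
        simp [f, ← hhe]
    have hsurj : Function.Surjective f := MonoidHom.range_eq_top.1 hft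
    have h3 : 3 ≤ n := by
      have := hn.two_le
      obtain ⟨m, rfl⟩ := hodd
      omega
    have : Group.IsSolvable K := hK
    exact auxB_perfect n h3 (ZMod p) (Group.isSolvable_of_surjective hsurj)

end PartB


section PartC

theorem auxC_noSmall {A : Type*} [NormedRing A] [NormedAlgebra ℝ A] (s : A) (m : ℕ) (hm : 0 < m)
    (hs : s ^ m = 1) (r : ℝ) (hr : r < 1) (h : ∀ k : ℕ, ‖s ^ k - 1‖ ≤ r) : s = 1 := by
  set e : A := (m : ℝ)⁻¹ • ∑ k ∈ Finset.range m, s ^ k with he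
  have hm' : (m : ℝ) ≠ 0 := by positivity
  have hse : s * e = e := by
    rw [he, mul_smul_comm, Finset.mul_sum]
    congr 1
    have h1 : ∑ k ∈ Finset.range m, s * s ^ k = ∑ k ∈ Finset.range m, s ^ (k + 1) := by
      apply Finset.sum_congr rfl; intro k _; rw [pow_succ']
    rw [h1]
    have h2 := Finset.sum_range_succ (fun k => s ^ k) m
    have h3 := Finset.sum_range_succ' (fun k => s ^ k) m
    rw [h2, hs, pow_zero] at h3
    exact (add_right_cancel h3).symm
  have hske : ∀ k : ℕ, s ^ k * e = e := by
    intro k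
    induction k with
    | zero => simp
    | succ k ih => rw [pow_succ, mul_assoc, hse, ih]
  have hee : e * e = e := by
    nth_rewrite 1 [he]
    rw [smul_mul_assoc, Finset.sum_mul, Finset.sum_congr rfl (fun k _ => hske k)]
    rw [Finset.sum_const, Finset.card_range, ← Nat.cast_smul_eq_nsmul ℝ, smul_smul,
      inv_mul_cancel₀ hm', one_smul]
  have hf : (1 - e) * (1 - e) = 1 - e := by
    rw [mul_sub, sub_mul, sub_mul, hee]; simp
  have hfn : ‖1 - e‖ ≤ r := by
    have h1 : 1 - e = (m : ℝ)⁻¹ • ∑ k ∈ Finset.range m, (1 - s ^ k) := by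
      rw [Finset.sum_sub_distrib, smul_sub, ← he]
      congr 1
      rw [Finset.sum_const, Finset.card_range, ← Nat.cast_smul_eq_nsmul ℝ, smul_smul,
        inv_mul_cancel₀ hm', one_smul]
    rw [h1, norm_smul, norm_inv, Real.norm_natCast]
    have h2 : ‖∑ k ∈ Finset.range m, (1 - s ^ k)‖ ≤ m * r := by
      refine (norm_sum_le _ _).trans ?_
      refine (Finset.sum_le_sum (fun k _ => ?_) : _ ≤ ∑ k ∈ Finset.range m, r).trans ?_
      · rw [norm_sub_rev]; exact h k
      · simp
    calc (m : ℝ)⁻¹ * ‖∑ k ∈ Finset.range m, (1 - s ^ k)‖ ≤ (m : ℝ)⁻¹ * (m * r) := by gcongr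
      _ = r := by field_simp
  have hf0 : 1 - e = 0 := by
    rw [← norm_eq_zero]
    have h1 : ‖1 - e‖ ≤ ‖1 - e‖ * ‖1 - e‖ := by
      nth_rewrite 1 [← hf]; exact norm_mul_le _ _
    have h0 := norm_nonneg (1 - e)
    nlinarith
  have : e = 1 := (sub_eq_zero.1 hf0).symm
  rw [this] at hse
  simpa using hse

theorem auxC_commute {A : Type*} [NormedRing A] [NormedAlgebra ℝ A] {G : Type*} [Group G]
    [Finite G] (ρ : G →* A) (hl : ∀ g a, ‖ρ g * a‖ = ‖a‖) (hr : ∀ g a, ‖a * ρ g‖ = ‖a‖)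
    (a b : G) (ha : ‖ρ a - 1‖ < 1 / 4) (hb : ‖ρ b - 1‖ < 1 / 4) :
    ρ a * ρ b = ρ b * ρ a := by
  have hcomm : ∀ x y : G, ‖ρ (x * y * x⁻¹ * y⁻¹) - 1‖ ≤ 2 * ‖ρ x - 1‖ * ‖ρ y - 1‖ := by
    intro x y
    rw [← hr (y * x)]
    have : (ρ (x * y * x⁻¹ * y⁻¹) - 1) * ρ (y * x) =
        (ρ x - 1) * (ρ y - 1) - (ρ y - 1) * (ρ x - 1) := by
      rw [sub_mul, ← map_mul, show x * y * x⁻¹ * y⁻¹ * (y * x) = x * y by group, map_mul, map_mul]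
      noncomm_ring
    rw [this]
    refine (norm_sub_le _ _).trans ?_
    have h1 := norm_mul_le (ρ x - 1) (ρ y - 1)
    have h2 := norm_mul_le (ρ y - 1) (ρ x - 1)
    nlinarith
  -- iterated commutators
  let f : G → G := fun c => a * c * a⁻¹ * c⁻¹
  have hiter : ∀ k : ℕ, ‖ρ (f^[k] b) - 1‖ ≤ (1 / 2) ^ k * (1 / 4) := by
    intro k
    induction k with
    | zero => simpa using hb.le
    | succ k ih =>
      rw [Function.iterate_succ_apply']
      refine (hcomm a _).trans ?_
      rw [pow_succ]
      have := norm_nonneg (ρ (f^[k] b) - 1)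
      nlinarith [norm_nonneg (ρ a - 1)]
  -- the iterated commutators are eventually trivial
  have hsmall : ∃ k : ℕ, ρ (f^[k] b) = 1 := by
    have hfin : (Set.range (fun g : G => ‖ρ g - 1‖)).Finite := Set.finite_range _
    by_contra hcon
    push Not at hcon
    have hpos : ∀ k, 0 < ‖ρ (f^[k] b) - 1‖ := fun k => by
      rw [norm_pos_iff, sub_ne_zero]; exact hcon k
    obtain ⟨δ, hδ, hδ2⟩ : ∃ δ : ℝ, 0 < δ ∧ ∀ k, δ ≤ ‖ρ (f^[k] b) - 1‖ := by
      have hf2 : (Set.range (fun k : ℕ => ‖ρ (f^[k] b) - 1‖)).Finite :=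
        hfin.subset (by rintro _ ⟨k, rfl⟩; exact ⟨_, rfl⟩)
      obtain ⟨x, ⟨k0, hk0⟩, hx⟩ := Set.exists_min_image _ id hf2 ⟨_, ⟨0, rfl⟩⟩
      refine ⟨x, hk0 ▸ hpos k0, fun k => hx _ ⟨k, rfl⟩⟩
    obtain ⟨k, hk⟩ := exists_pow_lt_of_lt_one hδ (show (1 / 2 : ℝ) < 1 by norm_num)
    have := hδ2 k
    have h2 := hiter k
    have h3 : (0 : ℝ) < (1 / 2) ^ k := by positivity
    linarith
  -- descend
  have hdesc : ∀ k : ℕ, ρ (f^[k + 1] b) = 1 → ρ (f b) = 1 := by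
    intro k
    induction k with
    | zero => intro h; simpa using h
    | succ k ih =>
      intro h
      apply ih
      set c := f^[k] b with hc
      have hc1 : f^[k + 1] b = f c := Function.iterate_succ_apply' f k b
      have hc2 : f^[k + 1 + 1] b = f (f c) := by
        rw [Function.iterate_succ_apply', hc1]
      rw [hc1]
      rw [hc2] at h
      have hcn : ‖ρ c - 1‖ ≤ 1 / 4 := by
        refine (hiter k).trans ?_
        have : (1 / 2 : ℝ) ^ k ≤ 1 := pow_le_one₀ (by norm_num) (by norm_num)
        linarith
      -- `ρ s` commutes with `ρ a`
      set s := f c with hs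
      have hsa : ρ a * ρ s = ρ s * ρ a := by
        have h1 : ρ (f s * (s * a)) = ρ (s * a) := by rw [map_mul, h, one_mul]
        rw [← map_mul, ← map_mul, ← h1]
        congr 1
        simp only [f]; group
      have hsac : ∀ m : ℕ, ρ (a ^ m * c * (a ^ m)⁻¹) = ρ s ^ m * ρ c := by
        intro m
        induction m with
        | zero => simp
        | succ m ihm =>
          have h1 : a ^ (m + 1) * c * (a ^ (m + 1))⁻¹ = a * (a ^ m * c * (a ^ m)⁻¹) * a⁻¹ := by
            rw [pow_succ' a m]; group
          have h2 : ρ a * ρ s ^ m = ρ s ^ m * ρ a := (Commute.pow_right hsa m)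
          rw [h1, map_mul, map_mul, ihm, ← mul_assoc, h2, mul_assoc, mul_assoc, pow_succ, mul_assoc]
          congr 1
          rw [← map_mul, ← map_mul, ← map_mul]
          congr 1
          simp only [hs, f]; group
      obtain ⟨m, hm, hms⟩ := (isOfFinOrder_of_finite s).exists_pow_eq_one
      refine auxC_noSmall (ρ s) m hm (by rw [← map_pow, hms, map_one]) (1 / 2) (by norm_num) ?_
      intro k
      rw [← hr c, sub_mul, ← hsac, one_mul]
      have h1 : ‖ρ (a ^ k * c * (a ^ k)⁻¹) - 1‖ = ‖ρ c - 1‖ := by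
        rw [← hr (a ^ k), sub_mul, ← map_mul, ← hl (a ^ k) (ρ c - 1), mul_sub, ← map_mul]
        simp
      calc ‖ρ (a ^ k * c * (a ^ k)⁻¹) - ρ c‖
          = ‖(ρ (a ^ k * c * (a ^ k)⁻¹) - 1) - (ρ c - 1)‖ := by congr 1; abel
        _ ≤ ‖ρ (a ^ k * c * (a ^ k)⁻¹) - 1‖ + ‖ρ c - 1‖ := norm_sub_le _ _
        _ ≤ 1 / 2 := by rw [h1]; linarith
  obtain ⟨k, hk⟩ := hsmall
  have hfb : ρ (f b) = 1 := by
    rcases k with _ | k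
    · have hb1 : ρ b = 1 := by simpa using hk
      have hb2 : ρ b⁻¹ = 1 := by
        have : ρ b * ρ b⁻¹ = 1 := by rw [← map_mul]; simp
        rwa [hb1, one_mul] at this
      simp only [f]
      rw [map_mul, map_mul, map_mul, hb1, hb2, mul_one, mul_one, ← map_mul]; simp
    · exact hdesc k hk
  have : ρ (f b * (b * a)) = ρ (b * a) := by rw [map_mul, hfb, one_mul]
  rw [← map_mul, ← map_mul, ← this]
  congr 1
  simp only [f]; group

open scoped Matrix.Norms.L2Operator in
theorem auxC_unitary (n : ℕ) (hn : 0 < n) : ∃ M : ℕ, 0 < M ∧ ∀ (G : Type) [Group G] [Finite G]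
    (ρ : G →* Matrix (Fin n) (Fin n) ℂ)
    (_ : ∀ g, ρ g ∈ unitary (Matrix (Fin n) (Fin n) ℂ)) (x y : G),
    ρ (x ^ M) * ρ (y ^ M) = ρ (y ^ M) * ρ (x ^ M) := by
  have : Nonempty (Fin n) := ⟨⟨0, hn⟩⟩
  have : ProperSpace (Matrix (Fin n) (Fin n) ℂ) := FiniteDimensional.proper ℂ _
  have htb := (isCompact_closedBall (0 : Matrix (Fin n) (Fin n) ℂ) 1).totallyBounded
  rw [Metric.totallyBounded_iff] at htb
  obtain ⟨t, htf, ht⟩ := htb (1 / 8) (by norm_num)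
  refine ⟨(t.ncard).factorial, Nat.factorial_pos _, ?_⟩
  intro G _ _ ρ hρ x y
  have hl : ∀ g a, ‖ρ g * a‖ = ‖a‖ := fun g a => CStarRing.norm_mem_unitary_mul a (hρ g)
  have hr : ∀ g a, ‖a * ρ g‖ = ‖a‖ := fun g a => CStarRing.norm_mul_mem_unitary a (hρ g)
  have hsm : ∀ x : G, ∃ k : ℕ, 0 < k ∧ k ≤ t.ncard ∧ ‖ρ (x ^ k) - 1‖ < 1 / 4 := by
    intro x
    have h1 : ∀ i : ℕ, ∃ z ∈ t, dist (ρ (x ^ i)) z < 1 / 8 := by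
      intro i
      have := ht (show ρ (x ^ i) ∈ Metric.closedBall (0 : Matrix (Fin n) (Fin n) ℂ) 1 by
        rw [mem_closedBall_zero_iff]; exact (CStarRing.norm_of_mem_unitary (hρ _)).le)
      simpa using this
    choose z hz hz2 using h1
    obtain ⟨i, hi, j, hj, hij, hzz⟩ := Finset.exists_ne_map_eq_of_card_lt_of_maps_to
      (s := Finset.range (t.ncard + 1)) (t := htf.toFinset) (f := z)
      (by rw [← Set.ncard_eq_toFinset_card t htf]; simp) (by intro i _; simpa using hz i)
    wlog hlt : i < j generalizing i j
    · exact this j hj i hi hij.symm hzz.symm (by omega)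
    refine ⟨j - i, by omega, by simp at hj; omega, ?_⟩
    rw [← hl (x ^ i), mul_sub, ← map_mul, ← pow_add, mul_one, ← dist_eq_norm]
    rw [show i + (j - i) = j by omega]
    have := dist_triangle_right (ρ (x ^ j)) (ρ (x ^ i)) (z j)
    have h3 := hz2 i
    rw [hzz] at h3
    linarith [hz2 j]
  obtain ⟨k, hk0, hk, hkx⟩ := hsm x
  obtain ⟨l, hl0, hl', hly⟩ := hsm y
  have hc : Commute (ρ (x ^ k)) (ρ (y ^ l)) := auxC_commute ρ hl hr _ _ hkx hly
  obtain ⟨u, hu⟩ := Nat.dvd_factorial hk0 hk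
  obtain ⟨v, hv⟩ := Nat.dvd_factorial hl0 hl'
  have h3 : x ^ (t.ncard).factorial = (x ^ k) ^ u := by rw [hu, pow_mul]
  have h4 : y ^ (t.ncard).factorial = (y ^ l) ^ v := by rw [hv, pow_mul]
  rw [h3, h4, map_pow _ (x ^ k), map_pow _ (y ^ l)]
  exact hc.pow_pow u v

open scoped ComplexOrder MatrixOrder Matrix.Norms.L2Operator in
theorem auxC_jordan (n : ℕ) (hn : 0 < n) : ∃ M : ℕ, 0 < M ∧ ∀ (G : Type) [Group G] [Finite G]
    (ρ : G →* Matrix (Fin n) (Fin n) ℂ) (x y : G),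
    ρ (x ^ M) * ρ (y ^ M) = ρ (y ^ M) * ρ (x ^ M) := by
  obtain ⟨M, hM, h⟩ := auxC_unitary n hn
  refine ⟨M, hM, ?_⟩
  intro G _ _ ρ x y
  classical
  have := Fintype.ofFinite G
  have hinv : ∀ g, ρ g * ρ g⁻¹ = 1 := fun g => by rw [← map_mul]; simp
  have hinv' : ∀ g, ρ g⁻¹ * ρ g = 1 := fun g => by rw [← map_mul]; simp
  let A : Matrix (Fin n) (Fin n) ℂ := ∑ g, (ρ g)ᴴ * ρ g
  have hApd : A.PosDef := by
    apply Matrix.posDef_sum Finset.univ_nonempty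
    intro g _
    apply Matrix.PosDef.conjTranspose_mul_self
    apply Function.LeftInverse.injective (g := (ρ g⁻¹).mulVec)
    intro v
    rw [Matrix.mulVec_mulVec, hinv', Matrix.one_mulVec]
  have hA : ∀ g, (ρ g)ᴴ * A * ρ g = A := by
    intro g
    simp only [A, Finset.mul_sum, Finset.sum_mul]
    rw [← Equiv.sum_comp (Equiv.mulRight g) (fun k => (ρ k)ᴴ * ρ k)]
    apply Finset.sum_congr rfl
    intro k _
    simp [Matrix.conjTranspose_mul, Matrix.mul_assoc]
  obtain ⟨B, hB⟩ := CStarAlgebra.nonneg_iff_eq_star_mul_self.mp hApd.posSemidef.nonneg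
  rw [Matrix.star_eq_conjTranspose] at hB
  have hBu : IsUnit B := by
    have h1 := hApd.isUnit
    rw [Matrix.isUnit_iff_isUnit_det, hB, Matrix.det_mul] at h1
    rw [Matrix.isUnit_iff_isUnit_det]
    exact isUnit_of_mul_isUnit_right h1
  obtain ⟨U, rfl⟩ := hBu
  let ρ' : G →* Matrix (Fin n) (Fin n) ℂ :=
    { toFun := fun g => U.1 * ρ g * U⁻¹.1
      map_one' := by simp
      map_mul' := by
        intro a b
        rw [map_mul]
        simp [mul_assoc] }
  have hρ' : ∀ g, ρ' g ∈ unitary (Matrix (Fin n) (Fin n) ℂ) := by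
    intro g
    have h1 : (ρ' g)ᴴ * ρ' g = 1 := by
      have h2 := hA g
      rw [hB] at h2
      have h3 : (U⁻¹.1)ᴴ * ((ρ g)ᴴ * ((U.1)ᴴ * U.1) * ρ g) * U⁻¹.1 = 1 := by
        rw [h2, ← Matrix.mul_assoc, ← Matrix.conjTranspose_mul, Matrix.mul_assoc]
        simp
      rw [← h3]
      change (U.1 * ρ g * U⁻¹.1)ᴴ * (U.1 * ρ g * U⁻¹.1) = _
      rw [Matrix.conjTranspose_mul, Matrix.conjTranspose_mul]
      simp only [Matrix.mul_assoc]
    rw [Unitary.mem_iff]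
    exact ⟨h1, mul_eq_one_comm.1 h1⟩
  have := h G ρ' hρ' x y
  rw [← map_mul, ← map_mul] at this ⊢
  have h2 : U.1 * ρ (x ^ M * y ^ M) * U⁻¹.1 = U.1 * ρ (y ^ M * x ^ M) * U⁻¹.1 := this
  have h3 := U⁻¹.isUnit.mul_right_cancel h2
  exact U.isUnit.mul_left_cancel h3

end PartC


section PartE

theorem auxE_step {R A : Type*} [CommRing R] [Ring A] [Algebra R A] {G : Type*} [Group G]
    [Fintype G] (π ν : R) (hν : ν * (Fintype.card G : R) = 1) (ρ σ : G → A)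
    (h1 : ∀ g, σ g * ρ g = 1) (h2 : ∀ g, ρ g * σ g = 1) (k : ℕ)
    (h : ∀ x y, ∃ c : A, ρ (x * y) - ρ x * ρ y = π ^ k • c) :
    ∃ ρ' : G → A, (∀ x y, ∃ c : A, ρ' (x * y) - ρ' x * ρ' y = π ^ (2 * k) • c) ∧
      ∀ x, ∃ c : A, ρ' x - ρ x = π ^ k • c := by
  choose c hc using h
  let b : G → G → A := fun x y => c x y * σ y
  have hb : ∀ x y, ρ (x * y) * σ y = ρ x + π ^ k • b x y := by
    intro x y
    have : ρ (x * y) = ρ x * ρ y + π ^ k • c x y := by rw [← hc]; abel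
    rw [this, add_mul, mul_assoc, h2, mul_one, smul_mul_assoc]
  let u : G → A := fun x => ν • ∑ y, b x y
  have hsum : ∀ a : A, ν • ∑ _y : G, a = a := by
    intro a
    rw [Finset.sum_const, Finset.card_univ, ← Nat.cast_smul_eq_nsmul R, smul_smul, hν, one_smul]
  refine ⟨fun x => ν • ∑ y, ρ (x * y) * σ y, ?_, ?_⟩
  · intro x y
    refine ⟨ν • ∑ h, b x (y * h) * b y h - u x * u y, ?_⟩
    have hr : ∀ x, ν • ∑ y, ρ (x * y) * σ y = ρ x + π ^ k • u x := by
      intro x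
      simp only [hb, Finset.sum_add_distrib, smul_add, hsum]
      rw [← Finset.smul_sum, smul_comm]
    have hux : u x = ν • ∑ h, b x (y * h) := by
      simp only [u]
      rw [← Equiv.sum_comp (Equiv.mulLeft y)]; rfl
    have key : ∀ h, ρ (x * y * h) * σ h = ρ x * ρ y + π ^ k • (b x (y * h) * ρ y)
        + π ^ k • (ρ x * b y h) + π ^ (2 * k) • (b x (y * h) * b y h) := by
      intro h
      have e1 : ρ (x * y * h) = (ρ x + π ^ k • b x (y * h)) * ρ (y * h) := by
        rw [← hb, mul_assoc (ρ _), h1, mul_one, mul_assoc]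
      rw [e1, mul_assoc, hb, two_mul, pow_add, add_mul, mul_add, mul_add]
      simp only [smul_mul_assoc, mul_smul_comm, smul_smul]
      abel
    simp only [key, Finset.sum_add_distrib, smul_add, hsum, hr]
    have huy : ρ x * u y = ν • (ρ x * ∑ h, b y h) := by simp only [u, mul_smul_comm]
    have hux2 : u x * ρ y = ν • ((∑ h, b x (y * h)) * ρ y) := by rw [hux, smul_mul_assoc]
    rw [← Finset.smul_sum, ← Finset.smul_sum, ← Finset.smul_sum, ← Finset.sum_mul,
      ← Finset.mul_sum, smul_comm ν, smul_comm ν, smul_comm ν, ← huy, ← hux2]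
    rw [add_mul, mul_add, mul_add, smul_sub]
    simp only [smul_mul_assoc, mul_smul_comm, smul_smul, ← pow_add, ← two_mul]
    abel
  · intro x
    refine ⟨u x, ?_⟩
    simp only [hb, Finset.sum_add_distrib, smul_add, hsum]
    rw [← Finset.smul_sum, smul_comm]
    simp [u]

theorem auxE_embed (p : ℕ) [Fact p.Prime] : Nonempty (ℚ_[p] →+* ℂ) := by
  open Cardinal in
  have h1 : #(ℚ_[p]) ≤ 𝔠 := by
    have hs : Function.Surjective (CauSeq.Completion.mk : CauSeq ℚ (padicNorm p) → _) :=
      Quotient.mk_surjective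
    have h2 : #(ℚ_[p]) ≤ #(CauSeq ℚ (padicNorm p)) := Cardinal.mk_le_of_surjective hs
    refine h2.trans ((Cardinal.mk_subtype_le _).trans ?_)
    simp
  open Cardinal in
  have h3 : #(AlgebraicClosure ℚ_[p]) ≤ 𝔠 := by
    refine (Algebra.IsAlgebraic.cardinalMk_le_max ℚ_[p] (AlgebraicClosure ℚ_[p])).trans ?_
    exact max_le h1 aleph0_le_continuum
  open Cardinal in
  have h4 : 𝔠 ≤ #(AlgebraicClosure ℚ_[p]) := by
    refine (continuum_le_cardinal_of_nontriviallyNormedField ℚ_[p]).trans ?_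
    exact Cardinal.mk_le_of_injective (algebraMap ℚ_[p] (AlgebraicClosure ℚ_[p])).injective
  have h5 := le_antisymm h3 h4
  have : CharZero (AlgebraicClosure ℚ_[p]) :=
    charZero_of_injective_algebraMap (algebraMap ℚ_[p] (AlgebraicClosure ℚ_[p])).injective
  obtain ⟨e⟩ := IsAlgClosed.ringEquiv_of_equiv_of_charZero (K := AlgebraicClosure ℚ_[p]) (L := ℂ)
    (by rw [h5]; exact Cardinal.aleph0_lt_continuum)
    (by rw [← Cardinal.eq, h5, Cardinal.mk_complex])
  exact ⟨e.toRingHom.comp (algebraMap ℚ_[p] (AlgebraicClosure ℚ_[p]))⟩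

theorem auxE_lift (n p : ℕ) [Fact p.Prime] (G : Subgroup (SL n (ZMod p)))
    (hG : ¬ p ∣ Nat.card G) : ∃ ρ : G →* Matrix (Fin n) (Fin n) ℤ_[p],
      ∀ g : G, (ρ g).map PadicInt.toZMod = ((g : SL n (ZMod p)) : Matrix (Fin n) (Fin n) (ZMod p)) := by
  classical
  have := Fintype.ofFinite G
  rw [Nat.card_eq_fintype_card] at hG
  let φ : Matrix (Fin n) (Fin n) ℤ_[p] →+* Matrix (Fin n) (Fin n) (ZMod p) :=
    (PadicInt.toZMod).mapMatrix
  have hφs : Function.Surjective (PadicInt.toZMod : ℤ_[p] →+* ZMod p) := ZMod.ringHom_surjective _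
  have hker : ∀ a, PadicInt.toZMod a = 0 ↔ ∃ c : ℤ_[p], a = (p : ℤ_[p]) * c := by
    intro a
    rw [← RingHom.mem_ker, PadicInt.ker_toZMod, PadicInt.maximalIdeal_eq_span_p,
      Ideal.mem_span_singleton]; rfl
  have hkerM : ∀ a, φ a = 0 ↔ ∃ c : Matrix (Fin n) (Fin n) ℤ_[p], a = (p : ℤ_[p]) • c := by
    intro a
    constructor
    · intro h
      have : ∀ i j, ∃ c : ℤ_[p], a i j = (p : ℤ_[p]) * c := fun i j => by
        rw [← hker]; exact congrFun (congrFun h i) j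
      choose c hc using this
      exact ⟨Matrix.of c, by ext i j; simp [hc]⟩
    · rintro ⟨c, rfl⟩
      ext i j
      change PadicInt.toZMod ((p : ℤ_[p]) * c i j) = 0
      simp
  have hunit : ∀ a, IsUnit (φ a) → IsUnit a := by
    intro a h
    rw [Matrix.isUnit_iff_isUnit_det] at h ⊢
    have h2 : φ a = a.map PadicInt.toZMod := rfl
    have h3 : (a.map (PadicInt.toZMod : ℤ_[p] →+* ZMod p)).det = PadicInt.toZMod a.det :=
      ((RingHom.map_det PadicInt.toZMod a).symm)
    rw [h2, h3] at h
    have : IsLocalHom (PadicInt.toZMod : ℤ_[p] →+* ZMod p) := IsLocalHom.of_surjective _ hφs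
    exact isUnit_of_map_unit _ _ h
  have hGu : ∀ g : G, IsUnit ((g : SL n (ZMod p)) : Matrix (Fin n) (Fin n) (ZMod p)) := by
    intro g
    rw [Matrix.isUnit_iff_isUnit_det]; simp
  obtain ⟨ν, hν⟩ : ∃ ν : ℤ_[p], ν * (Fintype.card G : ℤ_[p]) = 1 := by
    have : IsUnit (Fintype.card G : ℤ_[p]) := by
      have : IsLocalHom (PadicInt.toZMod : ℤ_[p] →+* ZMod p) :=
        IsLocalHom.of_surjective _ hφs
      apply isUnit_of_map_unit (PadicInt.toZMod : ℤ_[p] →+* ZMod p)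
      rw [map_natCast, isUnit_iff_ne_zero, Ne, ZMod.natCast_eq_zero_iff]
      exact hG
    obtain ⟨b, hb⟩ := this.exists_left_inv
    exact ⟨b, hb⟩
  let P : ℕ → (G → Matrix (Fin n) (Fin n) ℤ_[p]) → Prop := fun k ρ =>
    (∀ g : G, φ (ρ g) = ((g : SL n (ZMod p)) : Matrix (Fin n) (Fin n) (ZMod p))) ∧
    ∀ x y, ∃ c, ρ (x * y) - ρ x * ρ y = (p : ℤ_[p]) ^ (k + 1) • c
  have hstep : ∀ k ρ, P k ρ → ∃ ρ', P (k + 1) ρ' ∧ ∀ x, ∃ c, ρ' x - ρ x = (p : ℤ_[p]) ^ (k + 1) • c := by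
    intro k ρ hP
    have hu : ∀ g, IsUnit (ρ g) := fun g => hunit _ (by rw [hP.1]; exact hGu g)
    choose U hU using hu
    obtain ⟨ρ', h1, h2⟩ := auxE_step (p : ℤ_[p]) ν hν ρ (fun g => (U g)⁻¹.1)
      (fun g => by rw [← hU]; exact Units.inv_mul _) (fun g => by rw [← hU]; exact Units.mul_inv _)
      (k + 1) hP.2
    refine ⟨ρ', ⟨fun g => ?_, fun x y => ?_⟩, h2⟩
    · rw [← hP.1 g, ← sub_eq_zero, ← map_sub, hkerM]
      obtain ⟨c, hc⟩ := h2 g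
      exact ⟨(p : ℤ_[p]) ^ k • c, by rw [hc, smul_smul, pow_succ']⟩
    · obtain ⟨c, hc⟩ := h1 x y
      exact ⟨(p : ℤ_[p]) ^ k • c, by rw [hc, smul_smul, ← pow_add]; congr 2; ring⟩
  obtain ⟨ρ0, hρ0⟩ : ∃ ρ, P 0 ρ := by
    have : ∀ g : G, ∃ a, φ a = ((g : SL n (ZMod p)) : Matrix (Fin n) (Fin n) (ZMod p)) := by
      intro g
      choose s hs using hφs
      exact ⟨Matrix.of fun i j => s ((g : SL n (ZMod p)) i j), by ext i j; exact hs _⟩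
    choose ρ hρ using this
    refine ⟨ρ, hρ, fun x y => ?_⟩
    rw [zero_add, pow_one, ← hkerM, map_sub, map_mul, hρ, hρ, hρ]
    simp
  choose! F hF1 hF2 using hstep
  let S : ℕ → (G → Matrix (Fin n) (Fin n) ℤ_[p]) := fun k => Nat.rec ρ0 (fun k r => F k r) k
  have hS : ∀ k, P k (S k) := by
    intro k
    induction k with
    | zero => exact hρ0
    | succ k ih => exact hF1 k _ ih
  have hS2 : ∀ k x, ∃ c, S (k + 1) x - S k x = (p : ℤ_[p]) ^ (k + 1) • c :=
    fun k x => hF2 k _ (hS k) x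
  have hmod : ∀ k (a b : ℤ_[p]), a ≡ b [SMOD (IsLocalRing.maximalIdeal ℤ_[p] ^ k • ⊤ :
      Submodule ℤ_[p] ℤ_[p])] ↔ ∃ c, b - a = (p : ℤ_[p]) ^ k * c := by
    intro k a b
    rw [SModEq.comm, SModEq.sub_mem, PadicInt.maximalIdeal_eq_span_p, Ideal.span_singleton_pow, smul_eq_mul,
      Ideal.mul_top, Ideal.mem_span_singleton]; rfl
  have hS3 : ∀ x i j m l, m ≤ l → ∃ c, S l x i j - S m x i j = (p : ℤ_[p]) ^ m * c := by
    intro x i j m l hml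
    induction l, hml using Nat.le_induction with
    | base => exact ⟨0, by simp⟩
    | succ l hl ih =>
      obtain ⟨c, hc⟩ := ih
      obtain ⟨d, hd⟩ := hS2 l x
      have hd' : S (l + 1) x i j - S l x i j = (p : ℤ_[p]) ^ (l + 1) * d i j := by
        have := congrFun (congrFun hd i) j
        simpa using this
      refine ⟨p ^ (l + 1 - m) * d i j + c, ?_⟩
      have e : (p : ℤ_[p]) ^ (l + 1) = p ^ m * p ^ (l + 1 - m) := by
        rw [← pow_add]; congr 1; omega
      rw [e] at hd'
      linear_combination hc + hd'
  have hlim : ∀ x i j, ∃ L : ℤ_[p], ∀ m, ∃ c, L - S m x i j = (p : ℤ_[p]) ^ m * c := by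
    intro x i j
    obtain ⟨L, hL⟩ := IsPrecomplete.prec' (I := IsLocalRing.maximalIdeal ℤ_[p])
      (fun m => S m x i j) (fun {m l} hml => (hmod _ _ _).2 (hS3 x i j m l hml))
    exact ⟨L, fun m => (hmod _ _ _).1 (hL m)⟩
  choose L hL using hlim
  let ρ : G → Matrix (Fin n) (Fin n) ℤ_[p] := fun x => Matrix.of (L x)
  have hρ : ∀ m x, ∃ c, ρ x - S m x = (p : ℤ_[p]) ^ m • c := by
    intro m x
    choose c hc using fun i j => hL x i j m
    exact ⟨Matrix.of c, by ext i j; simp [ρ, hc]⟩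
  have hred : ∀ g : G, φ (ρ g) = ((g : SL n (ZMod p)) : Matrix (Fin n) (Fin n) (ZMod p)) := by
    intro g
    rw [← (hS 1).1 g, ← sub_eq_zero, ← map_sub, hkerM]
    simpa using hρ 1 g
  have hmul : ∀ x y, ρ (x * y) = ρ x * ρ y := by
    intro x y
    have key : ∀ m, ∃ c, ρ (x * y) - ρ x * ρ y = (p : ℤ_[p]) ^ m • c := by
      intro m
      obtain ⟨a, ha⟩ := hρ m x
      obtain ⟨b, hb⟩ := hρ m y
      obtain ⟨c, hc⟩ := hρ m (x * y)
      obtain ⟨d, hd⟩ := (hS m).2 x y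
      refine ⟨c + (p : ℤ_[p]) • d - a * S m y - ρ x * b, ?_⟩
      rw [smul_sub, smul_sub, smul_add, smul_smul, ← pow_succ, ← hc, ← hd, ← mul_smul_comm _ (ρ x), ← hb,
        ← smul_mul_assoc, ← ha]
      noncomm_ring
    rw [← sub_eq_zero]
    ext i j
    refine IsHausdorff.haus' (I := IsLocalRing.maximalIdeal ℤ_[p]) _ (fun m => ?_)
    rw [SModEq.comm, hmod]
    obtain ⟨c, hc⟩ := key m
    exact ⟨c i j, by rw [hc]; simp⟩
  refine ⟨⟨⟨ρ, ?_⟩, hmul⟩, hred⟩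
  have h1 : IsUnit (ρ 1) := hunit _ (by rw [hred]; exact hGu 1)
  have h2 := hmul 1 1
  rw [mul_one] at h2
  exact (h1.mul_left_cancel (by rw [mul_one]; exact h2)).symm

theorem auxE_jordan (n : ℕ) (hn : 0 < n) : ∃ M : ℕ, 0 < M ∧ ∀ (p : ℕ), p.Prime →
    ∀ G : Subgroup (SL n (ZMod p)), ¬ p ∣ Nat.card G → ∀ x ∈ G, ∀ y ∈ G,
      x ^ M * y ^ M = y ^ M * x ^ M := by
  obtain ⟨M, hM, h⟩ := auxC_jordan n hn
  refine ⟨M, hM, ?_⟩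
  intro p hp G hG x hx y hy
  have : Fact p.Prime := ⟨hp⟩
  have : NeZero p := ⟨hp.ne_zero⟩
  obtain ⟨ρ, hρ⟩ := auxE_lift n p G hG
  obtain ⟨ι⟩ := auxE_embed p
  let ι' : ℤ_[p] →+* ℂ := ι.comp (algebraMap ℤ_[p] ℚ_[p])
  have hι : Function.Injective ι' := by
    intro a b hab
    have := ι.injective hab
    exact Subtype.ext this
  have h1 := h G ((ι'.mapMatrix (m := Fin n)).toMonoidHom.comp ρ) ⟨x, hx⟩ ⟨y, hy⟩
  rw [← map_mul, ← map_mul] at h1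
  have h2 : (ρ (⟨x, hx⟩ ^ M * ⟨y, hy⟩ ^ M)) = (ρ (⟨y, hy⟩ ^ M * ⟨x, hx⟩ ^ M)) :=
    Matrix.map_injective hι h1
  have h3 := hρ (⟨x, hx⟩ ^ M * ⟨y, hy⟩ ^ M)
  rw [h2, hρ] at h3
  exact (Subtype.ext h3).symm

end PartE


section PartF

open Polynomial in
theorem auxF_rel (n : ℕ) (hn : n.Prime) (hodd : Odd n) {L : Type*} [Field L] [Algebra ℚ L]
    (T : Module.End ℤ (Additive Lˣ)) (x : Lˣ) (hIntegral : IsIntegral ℚ (x : L))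
    (hdeg : (minpoly ℚ (x : L)).natDegree = n)
    (hnorm : ∑ k ∈ Finset.range n, (T ^ k) (Additive.ofMul x) = 0)
    (e : ℤ[X]) (hed : e.natDegree < n) (he1 : e.eval 1 = 0)
    (he : aeval T e (Additive.ofMul x) = 0) : e = 0 := by
  have : Fact n.Prime := ⟨hn⟩
  have : CharZero L := algebraRat.charZero L
  by_contra hne
  -- x is not a root of unity
  have hroot : ∀ m : ℕ, 0 < m → (x : L) ^ m ≠ 1 := by
    intro m hm hx
    have hfin : IsOfFinOrder (x : L) := isOfFinOrder_iff_pow_eq_one.2 ⟨m, hm, hx⟩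
    have hr : 0 < orderOf (x : L) := hfin.orderOf_pos
    have hprim := IsPrimitiveRoot.orderOf (x : L)
    have hmin := Polynomial.cyclotomic_eq_minpoly_rat hprim hr
    have hmin' : cyclotomic (orderOf (x : L)) ℚ = minpoly ℚ (x : L) := by
      rw [hmin]; congr 1; exact Subsingleton.elim _ _
    rw [← hmin', natDegree_cyclotomic] at hdeg
    have h2 : orderOf (x : L) ≤ 2 := by
      by_contra hcon
      have := Nat.totient_even (n := orderOf (x : L)) (by omega)
      rw [hdeg] at this
      exact (Nat.not_even_iff_odd.2 hodd) this
    have h3 := hn.two_le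
    interval_cases hh : orderOf (x : L)
    · simp at hdeg; omega
    · simp at hdeg; omega
  -- coprimality
  have hirr : Irreducible (cyclotomic n ℚ) := cyclotomic.irreducible_rat hn.pos
  have hcop : IsCoprime (e.map (Int.castRingHom ℚ)) (cyclotomic n ℚ) := by
    rw [isCoprime_comm, hirr.coprime_iff_not_dvd]
    rintro ⟨c, hc⟩
    have hene : e.map (Int.castRingHom ℚ) ≠ 0 := by
      rw [Ne, Polynomial.map_eq_zero_iff (RingHom.injective_int _)]; exact hne
    have hcne : c ≠ 0 := by rintro rfl; exact hene (by rw [hc, mul_zero])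
    have hd : (e.map (Int.castRingHom ℚ)).natDegree = (n - 1) + c.natDegree := by
      rw [hc, natDegree_mul hirr.ne_zero hcne, natDegree_cyclotomic, Nat.totient_prime hn]
    have hd2 : (e.map (Int.castRingHom ℚ)).natDegree ≤ e.natDegree := natDegree_map_le
    have hc0 : c.natDegree = 0 := by omega
    obtain ⟨r, rfl⟩ := natDegree_eq_zero.1 hc0
    have h1 := congrArg (eval 1) hc
    rw [eval_mul, eval_C, eval_one_cyclotomic_prime] at h1
    have h2 : eval 1 (e.map (Int.castRingHom ℚ)) = ((e.eval 1 : ℤ) : ℚ) := by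
      have := eval_map_apply (Int.castRingHom ℚ) (p := e) 1
      simpa using this
    rw [h2, he1] at h1
    have h3 : (n : ℚ) ≠ 0 := by exact_mod_cast hn.ne_zero
    have : r = 0 := by simpa [h3] using h1
    exact hcne (by rw [this]; simp)
  obtain ⟨a, b, hab⟩ := hcop
  have hclear : ∀ a : ℚ[X], ∃ (m : ℤ) (a' : ℤ[X]), m ≠ 0 ∧ a'.map (Int.castRingHom ℚ) = C (m : ℚ) * a := by
    intro a
    obtain ⟨m, hm, hm2⟩ := IsLocalization.integerNormalization_spec (nonZeroDivisors ℤ) a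
    refine ⟨m, IsLocalization.integerNormalization (nonZeroDivisors ℤ) a,
      nonZeroDivisors.ne_zero hm, ?_⟩
    rw [← algebraMap_int_eq, hm2, ← smul_eq_C_mul, Int.cast_smul_eq_zsmul]
  obtain ⟨m₁, a', hm₁, ha'⟩ := hclear a
  obtain ⟨m₂, b', hm₂, hb'⟩ := hclear b
  have hZ : C m₂ * a' * e + C m₁ * b' * cyclotomic n ℤ = C (m₁ * m₂) := by
    apply Polynomial.map_injective (Int.castRingHom ℚ) (RingHom.injective_int _)
    simp only [Polynomial.map_add, Polynomial.map_mul, map_cyclotomic, ha', hb', map_C]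
    have h3 : C (m₁ : ℚ) * C (m₂ : ℚ) * (a * e.map (Int.castRingHom ℚ) + b * cyclotomic n ℚ)
      = C (m₁ : ℚ) * C (m₂ : ℚ) := by rw [hab, mul_one]
    simp only [Int.coe_castRingHom, C_mul, Int.cast_mul]
    rw [← h3]; ring
  have hcyc : aeval T (cyclotomic n ℤ) (Additive.ofMul x) = 0 := by
    rw [cyclotomic_prime, map_sum, LinearMap.sum_apply]
    simpa using hnorm
  have h4 := congrArg (fun q => aeval T q (Additive.ofMul x)) hZ
  simp only [map_add, map_mul, Module.End.mul_apply, LinearMap.add_apply, he, hcyc, map_zero, add_zero,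
    aeval_C] at h4
  have h5 : (m₁ * m₂) • (Additive.ofMul x) = 0 := by
    rw [h4]
    simp only [Module.algebraMap_end_apply, mul_smul]
  have hM : m₁ * m₂ ≠ 0 := mul_ne_zero hm₁ hm₂
  have h6 : x ^ (m₁ * m₂) = 1 := h5
  have h7 : x ^ ((m₁ * m₂).natAbs) = 1 := by
    rcases Int.natAbs_eq (m₁ * m₂) with h | h
    · rw [← zpow_natCast, ← h, h6]
    · rw [h, _root_.zpow_neg, inv_eq_one] at h6
      exact_mod_cast h6
  exact hroot _ (Int.natAbs_pos.2 hM) (by rw [← Units.val_pow_eq_pow_val, h7, Units.val_one])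

open Polynomial in
theorem auxF_gen (n : ℕ) (hn : n.Prime) (hodd : Odd n) [NeZero n] (h : SL n ℤ)
    (hirr : Irreducible (matQ h).charpoly) (L : Type) [Field L] [Algebra ℚ L] (s : L →+* L)
    (hs : ∀ y, s^[n] y = y) (x : L) (hx : s x ≠ x) (hxr : aeval x (matQ h).charpoly = 0) :
    ∃ (lam : ZMod n → L)
      (P : Matrix (Fin n) (ZMod n) L) (Q : Matrix (ZMod n) (Fin n) L),
      P * Q = 1 ∧ Q * P = 1 ∧
      (h : Matrix (Fin n) (Fin n) ℤ).map (Int.castRingHom L) * P = P * Matrix.diagonal lam ∧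
      (∀ i, lam i ≠ 0) ∧ (∀ N : ℕ, 0 < N → ∀ i j, lam i ^ N = lam j ^ N → i = j) ∧
      (∀ i j k l, i ≠ j → lam i * lam l = lam k * lam j → i = k ∧ j = l) ∧
      ∀ r i, s (P r i) = P r (i + 1) := by
  have : Fact n.Prime := ⟨hn⟩
  set f := (matQ h).charpoly with hf
  have hfm : f.Monic := Matrix.charpoly_monic _
  have hfd : f.natDegree = n := by rw [hf, Matrix.charpoly_natDegree_eq_dim, Fintype.card_fin]
  have hmin : minpoly ℚ x = f := (minpoly.eq_of_irreducible_of_monic hirr hxr hfm).symm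
  have hper : Function.minimalPeriod s x = n := by
    have h1 : Function.minimalPeriod s x ∣ n := Function.IsPeriodicPt.minimalPeriod_dvd (hs x)
    rcases (Nat.dvd_prime hn).1 h1 with h2 | h2
    · exact absurd (Function.minimalPeriod_eq_one_iff_isFixedPt.1 h2) hx
    · exact h2
  have hval : ∀ (k : ℕ) y, s^[(k : ZMod n).val] y = s^[k] y := by
    intro k y
    rw [ZMod.val_natCast]
    exact Function.IsPeriodicPt.iterate_mod_apply (f := s) (hs y) k
  have hsucc : ∀ (i : ZMod n) y, s (s^[i.val] y) = s^[(i + 1).val] y := by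
    intro i y
    rw [← Function.iterate_succ_apply' s, ← hval]
    congr 2
    simp
  set H : Matrix (Fin n) (Fin n) L := (h : Matrix (Fin n) (Fin n) ℤ).map (Int.castRingHom L) with hH
  obtain ⟨v, hv0, hv⟩ : ∃ v ≠ 0, H *ᵥ v = x • v := by
    have h1 : H = (matQ h).map (algebraMap ℚ L) := by
      ext i j; simp [H, matQ]
    have h2 : H.charpoly = f.map (algebraMap ℚ L) := by
      rw [h1, Matrix.charpoly_map]
    have h3 : (Matrix.scalar (Fin n) x - H).det = 0 := by
      rw [← Matrix.eval_charpoly, h2, eval_map_algebraMap, hxr]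
    obtain ⟨v, hv0, hv⟩ := Matrix.exists_mulVec_eq_zero_iff.2 h3
    refine ⟨v, hv0, ?_⟩
    rw [Matrix.sub_mulVec, sub_eq_zero] at hv
    rw [← hv]
    ext i; simp [Matrix.mulVec_diagonal]
  have hHs : ∀ i j, s (H i j) = H i j := by intro i j; simp [H]
  have hvk : ∀ k : ℕ, H *ᵥ (fun r => s^[k] (v r)) = s^[k] x • (fun r => s^[k] (v r)) := by
    intro k
    induction k with
    | zero => simpa using hv
    | succ k ih =>
      ext r
      have := congrArg s (congrFun ih r)
      simp only [Matrix.mulVec, dotProduct, map_sum, map_mul, hHs, Pi.smul_apply, smul_eq_mul] at this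
      simp only [Matrix.mulVec, dotProduct, Function.iterate_succ_apply', Pi.smul_apply, smul_eq_mul, this]
  let lam : ZMod n → L := fun i => s^[i.val] x
  have hlam : Function.Injective lam := by
    intro i j hij
    have := (Function.iterate_eq_iterate_iff_of_lt_minimalPeriod (f := s) (x := x)
      (by rw [hper]; exact ZMod.val_lt i) (by rw [hper]; exact ZMod.val_lt j)).1 hij
    exact ZMod.val_injective n this
  let P : Matrix (Fin n) (ZMod n) L := Matrix.of fun r i => s^[i.val] (v r)
  have hHP : H * P = P * Matrix.diagonal lam := by
    ext r i
    have := congrFun (hvk i.val) r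
    rw [Matrix.mul_diagonal]
    simp only [Matrix.mulVec, dotProduct, Pi.smul_apply, smul_eq_mul] at this
    simp only [Matrix.mul_apply, P, Matrix.of_apply, this, lam]
    exact mul_comm _ _
  have hsinj : ∀ k : ℕ, Function.Injective s^[k] := fun k => s.injective.iterate k
  have hs0 : ∀ k : ℕ, s^[k] 0 = 0 := fun k => Function.iterate_fixed (map_zero s) k
  have hli : LinearIndependent L (fun i : ZMod n => P.col i) := by
    refine Module.End.eigenvectors_linearIndependent' (Matrix.toLin' H) lam hlam _ ?_
    intro i
    rw [Module.End.hasEigenvector_iff, Module.End.mem_eigenspace_iff]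
    refine ⟨hvk i.val, ?_⟩
    intro h0
    apply hv0
    ext r
    have := congrFun h0 r
    exact hsinj i.val (this.trans (hs0 _).symm)
  let e : Fin n ≃ ZMod n := Fintype.equivOfCardEq (by simp [ZMod.card])
  have hPu : IsUnit (P.submatrix id e) := by
    rw [← Matrix.linearIndependent_cols_iff_isUnit]
    exact hli.comp e e.injective
  obtain ⟨U, hU⟩ := hPu
  let Q : Matrix (ZMod n) (Fin n) L := (U⁻¹.1).submatrix e.symm id
  have hPQ : P * Q = 1 := by
    have h1 : P = U.1.submatrix id e.symm := by rw [hU]; ext; simp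
    rw [h1, Matrix.submatrix_mul_equiv]
    simp
  have hQP : Q * P = 1 := by
    have h1 : P = U.1.submatrix id e.symm := by rw [hU]; ext; simp
    rw [h1]
    have h2 := Matrix.submatrix_mul (U⁻¹.1) U.1 e.symm (id : Fin n → Fin n) e.symm Function.bijective_id
    rw [← h2]
    simp
  have hdet : ∏ i, lam i = 1 := by
    have h1 : H * U.1 = U.1 * Matrix.diagonal (lam ∘ e) := by
      rw [hU]
      ext r i
      have := congrFun (congrFun hHP r) (e i)
      rw [Matrix.mul_diagonal] at this ⊢
      exact this
    have h2 := congrArg Matrix.det h1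
    rw [Matrix.det_mul, Matrix.det_mul, mul_comm, Matrix.det_diagonal] at h2
    have h3 : U.1.det ≠ 0 := ((Matrix.isUnit_iff_isUnit_det _).1 U.isUnit).ne_zero
    have h4 := mul_left_cancel₀ h3 h2
    have h5 : H.det = 1 := by
      have h6 : H = (Int.castRingHom L).mapMatrix (h : Matrix (Fin n) (Fin n) ℤ) := rfl
      rw [h6, ← RingHom.map_det]; simp
    rw [h5] at h4
    rw [← Equiv.prod_comp e, h4]; rfl
  have hx0 : x ≠ 0 := by
    rintro rfl
    exact hx (map_zero s)
  let xu : Lˣ := Units.mk0 x hx0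
  let T : Module.End ℤ (Additive Lˣ) :=
    (MonoidHom.toAdditive (Units.map (s : L →* L))).toIntLinearMap
  have hT : ∀ k : ℕ, ((Additive.toMul ((T ^ k) (Additive.ofMul xu)) : Lˣ) : L) = s^[k] x := by
    intro k
    induction k with
    | zero => simp [xu]
    | succ k ih =>
      rw [pow_succ', Module.End.mul_apply, Function.iterate_succ_apply', ← ih]
      rfl
  have hnorm : ∑ k ∈ Finset.range n, (T ^ k) (Additive.ofMul xu) = 0 := by
    apply Additive.toMul.injective
    apply Units.ext
    rw [toMul_sum, toMul_zero, Units.coe_prod, Units.val_one, ← hdet]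
    simp only [hT]
    refine Finset.prod_nbij' (fun k : ℕ => (k : ZMod n)) (fun i => i.val) ?_ ?_ ?_ ?_ ?_
    · intro a _; simp
    · intro a _; simp [ZMod.val_lt]
    · intro a ha; rw [ZMod.val_natCast_of_lt (by simpa using ha)]
    · intro a _; simp
    · intro a ha; simp only [lam, hval]
  have hrel := auxF_rel n hn hodd T xu (by
    refine ⟨f, hfm, ?_⟩
    exact hxr) (by change (minpoly ℚ x).natDegree = n; rw [hmin, hfd]) hnorm
  have hinjT : ∀ (a b : Additive Lˣ), ((Additive.toMul a : Lˣ) : L) = ((Additive.toMul b : Lˣ) : L) → a = b := by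
    intro a b hab
    exact Additive.toMul.injective (Units.ext hab)
  have hdeg : ∀ i : ZMod n, (X ^ i.val : ℤ[X]).natDegree < n := fun i => by
    rw [natDegree_X_pow]; exact ZMod.val_lt i
  refine ⟨lam, P, Q, hPQ, hQP, hHP, ?_, ?_, ?_, ?_⟩
  · intro i h0
    exact hx0 (hsinj i.val (h0.trans (hs0 _).symm))
  · intro N hN i j hij
    by_contra hne
    have hne' : i.val ≠ j.val := fun h => hne (ZMod.val_injective n h)
    have h1 := hrel (C (N : ℤ) * X ^ i.val - C (N : ℤ) * X ^ j.val)
      (lt_of_le_of_lt (natDegree_sub_le _ _) (max_lt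
        (lt_of_le_of_lt (natDegree_C_mul_le _ _) (hdeg i))
        (lt_of_le_of_lt (natDegree_C_mul_le _ _) (hdeg j)))) (by simp) (by
        simp only [map_sub, map_mul, aeval_C, map_pow, aeval_X, LinearMap.sub_apply,
          Module.End.mul_apply, Module.algebraMap_end_apply]
        rw [sub_eq_zero]
        apply hinjT
        simp only [toMul_zsmul, zpow_natCast, Units.val_pow_eq_pow_val, hT]
        exact hij)
    have h2 := congrArg (fun q => q.coeff i.val) h1
    simp [coeff_X_pow, hne'] at h2
    omega
  · intro i j k l hij hh
    have hij' : i.val ≠ j.val := fun h => hij (ZMod.val_injective n h)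
    have h1 := hrel (X ^ i.val + X ^ l.val - (X ^ k.val + X ^ j.val))
      (lt_of_le_of_lt (natDegree_sub_le _ _) (max_lt
        (lt_of_le_of_lt (natDegree_add_le _ _) (max_lt (hdeg i) (hdeg l)))
        (lt_of_le_of_lt (natDegree_add_le _ _) (max_lt (hdeg k) (hdeg j))))) (by simp) (by
        simp only [map_sub, map_add, map_pow, aeval_X, LinearMap.sub_apply, LinearMap.add_apply]
        rw [sub_eq_zero]
        apply hinjT
        simp only [toMul_add, Units.val_mul, hT]
        exact hh)
    have hik : i.val = k.val := by
      have h2 := congrArg (fun q => q.coeff i.val) h1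
      by_contra hne
      simp [coeff_X_pow, hij', hne] at h2
      split_ifs at h2 <;> omega
    refine ⟨ZMod.val_injective n hik, ?_⟩
    have h2 := congrArg (fun q => q.coeff j.val) h1
    by_contra hne
    have hne' : j.val ≠ l.val := fun h => hne (ZMod.val_injective n h)
    rw [hik] at h2
    simp [coeff_X_pow, hne'] at h2
  · intro r i
    exact hsucc i (v r)

open Polynomial in
theorem auxF_main (n : ℕ) (hn : n.Prime) (hodd : Odd n) [NeZero n] (h : SL n ℤ)
    (hirr : Irreducible (matQ h).charpoly) :
    ∃ (L : Type) (_ : Field L) (_ : Algebra ℚ L) (s : L →+* L) (lam : ZMod n → L)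
      (P : Matrix (Fin n) (ZMod n) L) (Q : Matrix (ZMod n) (Fin n) L),
      P * Q = 1 ∧ Q * P = 1 ∧
      (h : Matrix (Fin n) (Fin n) ℤ).map (Int.castRingHom L) * P = P * Matrix.diagonal lam ∧
      (∀ i, lam i ≠ 0) ∧ (∀ N : ℕ, 0 < N → ∀ i j, lam i ^ N = lam j ^ N → i = j) ∧
      (∀ i j k l, i ≠ j → lam i * lam l = lam k * lam j → i = k ∧ j = l) ∧
      ∀ r i, s (P r i) = P r (i + 1) := by
  set f := (matQ h).charpoly with hf
  have hfm : f.Monic := Matrix.charpoly_monic _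
  have hfd : f.natDegree = n := by rw [hf, Matrix.charpoly_natDegree_eq_dim, Fintype.card_fin]
  have hdvd := Polynomial.Gal.prime_degree_dvd_card hirr (by rw [hfd]; exact hn)
  rw [hfd] at hdvd
  have : Fact n.Prime := ⟨hn⟩
  obtain ⟨σ, hσ⟩ := exists_prime_orderOf_dvd_card' n hdvd
  have hσ1 : σ ≠ 1 := by
    rintro rfl
    rw [orderOf_one] at hσ
    exact hn.one_lt.ne hσ
  obtain ⟨x, hxr, hx⟩ : ∃ x ∈ f.rootSet f.SplittingField, σ x ≠ x := by
    by_contra hcon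
    push Not at hcon
    exact hσ1 (Polynomial.Gal.ext (p := f) hcon)
  have hσn : ∀ y, σ^[n] y = y := by
    intro y
    have h1 : σ ^ n = 1 := hσ ▸ pow_orderOf_eq_one σ
    have h2 : (σ ^ n) y = σ^[n] y := by
      exact congrFun (AlgEquiv.coe_pow σ n) y
    rw [← h2, h1]; rfl
  have hxr2 : aeval x (matQ h).charpoly = 0 := (mem_rootSet.1 hxr).2
  obtain ⟨lam, P, Q, hh⟩ := auxF_gen n hn hodd h hirr f.SplittingField
    (σ : f.SplittingField ≃ₐ[ℚ] f.SplittingField).toRingEquiv.toRingHom hσn x hx hxr2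
  exact ⟨f.SplittingField, inferInstance, inferInstance, _, lam, P, Q, hh⟩

end PartF


section PartS

/-- An integral matrix of determinant one, viewed over a ring `L`. -/
def auxToL (n : ℕ) (L : Type*) [CommRing L] : SL n ℤ →* Matrix (Fin n) (Fin n) L where
  toFun g := (g : Matrix (Fin n) (Fin n) ℤ).map (Int.castRingHom L)
  map_one' := by
    have := ((Int.castRingHom L).mapMatrix (m := Fin n)).map_one
    simpa using this
  map_mul' a b := by
    have := (Int.castRingHom L).mapMatrix.map_mul (a : Matrix (Fin n) (Fin n) ℤ) b
    simpa using this

theorem auxToL_inj (n : ℕ) (L : Type*) [Field L] [CharZero L] :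
    Function.Injective (auxToL n L) := by
  intro a b hab
  apply Subtype.ext
  exact Matrix.map_injective (RingHom.injective_int _) hab

theorem auxS_diag {n : ℕ} {ι : Type*} [Fintype ι] [DecidableEq ι] {L : Type*} [Field L]
    (P : Matrix (Fin n) ι L) (Q : Matrix ι (Fin n) L)
    (hPQ : P * Q = 1) (hQP : Q * P = 1) (K : Matrix (Fin n) (Fin n) L)
    (mu : ι → L) (hmu : Function.Injective mu)
    (hK : K * P = P * Matrix.diagonal mu) (M : Matrix (Fin n) (Fin n) L) (hM : M * K = K * M) :
    ∃ nu : ι → L, M * P = P * Matrix.diagonal nu := by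
  have h1 : (Q * M * P) * Matrix.diagonal mu = Matrix.diagonal mu * (Q * M * P) := by
    have h2 : Q * K = Matrix.diagonal mu * Q := by
      calc Q * K = Q * (K * P) * Q := by rw [Matrix.mul_assoc, Matrix.mul_assoc, hPQ, Matrix.mul_one]
        _ = Matrix.diagonal mu * Q := by rw [hK, ← Matrix.mul_assoc, hQP, Matrix.one_mul]
    calc (Q * M * P) * Matrix.diagonal mu = Q * (M * K) * P := by
          simp only [Matrix.mul_assoc, hK]
      _ = (Q * K) * M * P := by rw [hM]; simp only [Matrix.mul_assoc]
      _ = _ := by rw [h2]; simp only [Matrix.mul_assoc]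
  refine ⟨fun i => (Q * M * P) i i, ?_⟩
  have h3 : Q * M * P = Matrix.diagonal (fun i => (Q * M * P) i i) := by
    ext i j
    by_cases hij : i = j
    · subst hij; simp
    · rw [Matrix.diagonal_apply_ne _ hij]
      have := congrFun (congrFun h1 i) j
      rw [Matrix.mul_diagonal, Matrix.diagonal_mul] at this
      have hne : mu i - mu j ≠ 0 := sub_ne_zero.2 (fun h => hij (hmu h))
      have h4 : (mu i - mu j) * (Q * M * P) i j = 0 := by linear_combination -this
      exact (mul_eq_zero.1 h4).resolve_left hne
  rw [← h3, ← Matrix.mul_assoc, ← Matrix.mul_assoc, hPQ, Matrix.one_mul]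

theorem auxS {n : ℕ} {ι : Type*} [Fintype ι] [DecidableEq ι] {L : Type*} [Field L] [CharZero L]
    (H : Subgroup (SL n ℤ)) (h : SL n ℤ) (hh : h ∈ H) (lam : ι → L)
    (P : Matrix (Fin n) ι L) (Q : Matrix ι (Fin n) L)
    (hPQ : P * Q = 1) (hQP : Q * P = 1) (hP : auxToL n L h * P = P * Matrix.diagonal lam)
    (N : ℕ) (hlam : ∀ i j, lam i ^ N = lam j ^ N → i = j)
    (hcomm : ∀ x ∈ H, (x * h ^ N * x⁻¹) * h ^ N = h ^ N * (x * h ^ N * x⁻¹)) :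
    SolvableByFinite H := by
  set k := h ^ N with hk
  set φ := auxToL n L with hφ
  have hinj : Function.Injective φ := auxToL_inj n L
  let mu : ι → L := fun i => lam i ^ N
  have hmu : Function.Injective mu := fun i j hij => hlam i j hij
  have hkP : φ k * P = P * Matrix.diagonal mu := by
    have : ∀ N : ℕ, φ (h ^ N) * P = P * Matrix.diagonal (fun i => lam i ^ N) := by
      intro N
      induction N with
      | zero => simp
      | succ N ih =>
        rw [pow_succ, map_mul, Matrix.mul_assoc, hP, ← Matrix.mul_assoc, ih, Matrix.mul_assoc,
          Matrix.diagonal_mul_diagonal]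
        simp [pow_succ]
    exact this N
  have hd : ∀ y : SL n ℤ, y * k = k * y → ∃ nu : ι → L, φ y * P = P * Matrix.diagonal nu := by
    intro y hy
    exact auxS_diag P Q hPQ hQP (φ k) mu hmu hkP (φ y) (by rw [← map_mul, ← map_mul, hy])
  have hcancel : ∀ A B : Matrix (Fin n) (Fin n) L, A * P = B * P → A = B := by
    intro A B hAB
    have := congrArg (fun C => C * Q) hAB
    simpa [Matrix.mul_assoc, hPQ] using this
  have hj : ∀ x : H, ∃ j : ι → ι, φ (x * k * (x : SL n ℤ)⁻¹) * P =
      P * Matrix.diagonal (fun i => mu (j i)) := by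
    intro x
    obtain ⟨nu, hnu⟩ := hd _ (hcomm x x.2)
    let Z := Q * φ (x : SL n ℤ)⁻¹ * P
    have hZ : Matrix.diagonal mu * Z = Z * Matrix.diagonal nu := by
      have h2 : Matrix.diagonal mu * Q = Q * φ k := by
        calc Matrix.diagonal mu * Q = Q * (P * Matrix.diagonal mu) * Q := by
              rw [← Matrix.mul_assoc, hQP, Matrix.one_mul]
          _ = _ := by rw [← hkP, Matrix.mul_assoc, Matrix.mul_assoc, hPQ, Matrix.mul_one]
      calc Matrix.diagonal mu * Z = (Matrix.diagonal mu * Q) * φ (x : SL n ℤ)⁻¹ * P := by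
            simp only [Z, Matrix.mul_assoc]
        _ = Q * φ (k * (x : SL n ℤ)⁻¹) * P := by rw [h2, map_mul]; simp only [Matrix.mul_assoc]
        _ = Q * φ ((x : SL n ℤ)⁻¹ * (x * k * (x : SL n ℤ)⁻¹)) * P := by
            congr 3; group
        _ = Q * φ ((x : SL n ℤ)⁻¹) * (φ (x * k * (x : SL n ℤ)⁻¹) * P) := by
            rw [map_mul]; simp only [Matrix.mul_assoc]
        _ = _ := by rw [hnu]; simp only [Z, Matrix.mul_assoc]
    have hZ1 : (Q * φ (x : SL n ℤ) * P) * Z = 1 := by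
      calc (Q * φ (x : SL n ℤ) * P) * Z
          = Q * φ (x : SL n ℤ) * (P * Q) * φ (x : SL n ℤ)⁻¹ * P := by
            simp only [Z, Matrix.mul_assoc]
        _ = Q * (φ (x : SL n ℤ) * φ (x : SL n ℤ)⁻¹) * P := by
            rw [hPQ, Matrix.mul_one]; simp only [Matrix.mul_assoc]
        _ = 1 := by rw [← map_mul, mul_inv_cancel, map_one, Matrix.mul_one, hQP]
    have : ∀ i, ∃ j, nu i = mu j := by
      intro i
      have h1 : ∃ j, Z j i ≠ 0 := by
        by_contra hcon
        push Not at hcon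
        have := congrFun (congrFun hZ1 i) i
        rw [Matrix.mul_apply] at this
        simp [hcon] at this
      obtain ⟨j, hj⟩ := h1
      refine ⟨j, ?_⟩
      have := congrFun (congrFun hZ j) i
      rw [Matrix.mul_diagonal, Matrix.diagonal_mul, mul_comm] at this
      exact (mul_left_cancel₀ hj this).symm
    choose j hj using this
    refine ⟨j, ?_⟩
    rw [hnu]
    congr 2
    ext i; exact hj i
  choose j hj using hj
  let kH : H := ⟨k, H.pow_mem hh N⟩
  let C : Subgroup H := Subgroup.centralizer {kH}
  have hC : ∀ y : H, y ∈ C ↔ (y : SL n ℤ) * k = k * y := by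
    intro y
    rw [Subgroup.mem_centralizer_singleton_iff]
    constructor
    · intro h; exact congrArg Subtype.val h
    · intro h; exact Subtype.ext h
  refine ⟨C, ?_, ?_⟩
  · apply isSolvable_of_comm
    rintro ⟨a, ha⟩ ⟨b, hb⟩
    apply Subtype.ext; apply Subtype.ext
    change (a : SL n ℤ) * b = b * a
    obtain ⟨u, hu⟩ := hd _ ((hC a).1 ha)
    obtain ⟨v, hv⟩ := hd _ ((hC b).1 hb)
    apply hinj
    apply hcancel
    rw [map_mul, map_mul, Matrix.mul_assoc, hv, ← Matrix.mul_assoc, hu, Matrix.mul_assoc,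
      Matrix.mul_assoc, hu, ← Matrix.mul_assoc (φ _), hv, Matrix.mul_assoc,
      Matrix.diagonal_mul_diagonal, Matrix.diagonal_mul_diagonal]
    simp only [mul_comm]
  · have : Finite (H ⧸ C) := by
      refine Finite.of_injective (fun q : H ⧸ C => j q.out) ?_
      intro a b hab
      have hab' : j a.out = j b.out := hab
      have h1 : φ (a.out * k * (a.out : SL n ℤ)⁻¹) = φ (b.out * k * (b.out : SL n ℤ)⁻¹) := by
        apply hcancel
        rw [hj, hj, hab']
      have h2 := hinj h1
      rw [← Quotient.out_eq' a, ← Quotient.out_eq' b]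
      refine QuotientGroup.eq.2 ((hC _).2 ?_)
      push_cast
      have h3 : k * (a.out : SL n ℤ)⁻¹ = (a.out : SL n ℤ)⁻¹ * (b.out * k * (b.out : SL n ℤ)⁻¹) := by
        rw [← h2]; group
      calc (a.out : SL n ℤ)⁻¹ * b.out * k =
            (a.out : SL n ℤ)⁻¹ * (b.out * k * (b.out : SL n ℤ)⁻¹) * b.out := by group
        _ = _ := by rw [← h3]; group
    exact Subgroup.finiteIndex_of_finite_quotient

end PartS


section PartS2

theorem auxS_order (n : ℕ) (hn : n.Prime) (hodd : Odd n) (H : Subgroup (SL n ℤ)) (h : SL n ℤ)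
    (hh : h ∈ H) (hirr : Irreducible (matQ h).charpoly) (hns : ¬ SolvableByFinite H) :
    ∃ B : ℕ, ∀ p : ℕ, p.Prime → B < p → p ∣ Nat.card (H.map (redMod n p)) := by
  have : NeZero n := ⟨hn.ne_zero⟩
  obtain ⟨M, hM, hJ⟩ := auxE_jordan n hn.pos
  obtain ⟨L, _, _, s, lam, P, Q, hPQ, hQP, hP, -, hlam, -, -⟩ := auxF_main n hn hodd h hirr
  have : CharZero L := algebraRat.charZero L
  by_contra hcon
  push Not at hcon
  apply hns
  have hc : ∀ x ∈ H, ∀ y ∈ H, x ^ M * y ^ M = y ^ M * x ^ M := by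
    intro x hx y hy
    apply Subtype.ext
    ext i j
    rw [← sub_eq_zero]
    set z : ℤ := (x ^ M * y ^ M : SL n ℤ) i j - (y ^ M * x ^ M : SL n ℤ) i j with hz
    obtain ⟨p, hp, hpz, hpc⟩ := hcon z.natAbs
    have h1 := hJ p hp _ hpc (redMod n p x) ⟨x, hx, rfl⟩ (redMod n p y) ⟨y, hy, rfl⟩
    rw [← map_pow, ← map_pow, ← map_mul, ← map_mul] at h1
    have h2 := congrFun (congrFun (congrArg Subtype.val h1) i) j
    have h3 : ((z : ℤ) : ZMod p) = 0 := by
      rw [hz, Int.cast_sub, sub_eq_zero]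
      exact h2
    rw [ZMod.intCast_zmod_eq_zero_iff_dvd] at h3
    by_contra hne
    have := Nat.le_of_dvd (Int.natAbs_pos.2 hne) (Int.natCast_dvd.1 h3)
    omega
  refine auxS H h hh lam P Q hPQ hQP hP M (hlam M hM) ?_
  intro x hx
  have : x * h ^ M * x⁻¹ = (x * h * x⁻¹) ^ M := by rw [conj_pow]
  rw [this]
  exact hc _ (H.mul_mem (H.mul_mem hx hh) (H.inv_mem hx)) _ hh

end PartS2


section PartG

/-- Conjugation by an integral matrix, as an operator on matrices over `L`. -/
def auxAd (n : ℕ) (L : Type*) [CommRing L] (x : SL n ℤ) :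
    Module.End L (Matrix (Fin n) (Fin n) L) where
  toFun c := auxToL n L x * c * auxToL n L x⁻¹
  map_add' a b := by rw [mul_add, add_mul]
  map_smul' a b := by simp

/-- Commutator with a given matrix. -/
def auxad {n : ℕ} {L : Type*} [CommRing L] (c : Matrix (Fin n) (Fin n) L) :
    Module.End L (Matrix (Fin n) (Fin n) L) where
  toFun d := c * d - d * c
  map_add' a b := by noncomm_ring
  map_smul' a b := by simp [smul_sub]

theorem auxAd_mul (n : ℕ) (L : Type*) [CommRing L] (x y : SL n ℤ) :
    auxAd n L (x * y) = auxAd n L x * auxAd n L y := by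
  ext1 c
  simp only [auxAd, LinearMap.coe_mk, AddHom.coe_mk, Module.End.mul_apply, _root_.mul_inv_rev, map_mul,
    mul_assoc]

theorem auxAd_one (n : ℕ) (L : Type*) [CommRing L] : auxAd n L 1 = 1 := by
  ext1 c
  simp [auxAd]

theorem auxad_Ad {n : ℕ} {L : Type*} [CommRing L] (x : SL n ℤ) (c : Matrix (Fin n) (Fin n) L) :
    auxad (auxAd n L x c) = auxAd n L x * auxad c * auxAd n L x⁻¹ := by
  have h1 : auxToL n L x * auxToL n L x⁻¹ = 1 := by rw [← map_mul]; simp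
  ext1 d
  simp only [auxAd, auxad, LinearMap.coe_mk, AddHom.coe_mk, Module.End.mul_apply, inv_inv, mul_sub,
    sub_mul]
  congr 1
  · simp only [mul_assoc, h1, mul_one]
  · simp only [← mul_assoc, h1, one_mul]

/-- The span of conjugation operators. -/
def auxA (n : ℕ) (L : Type*) [CommRing L] (H : Subgroup (SL n ℤ)) :
    Submodule L (Module.End L (Matrix (Fin n) (Fin n) L)) :=
  Submodule.span L (Set.range fun x : H => auxAd n L (x : SL n ℤ))

theorem auxA_Ad_mem {n : ℕ} {L : Type*} [CommRing L] {H : Subgroup (SL n ℤ)} {x : SL n ℤ}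
    (hx : x ∈ H) : auxAd n L x ∈ auxA n L H := Submodule.subset_span ⟨⟨x, hx⟩, rfl⟩

theorem auxA_Ad_mul {n : ℕ} {L : Type*} [CommRing L] {H : Subgroup (SL n ℤ)} {x : SL n ℤ}
    (hx : x ∈ H) {T} (hT : T ∈ auxA n L H) : auxAd n L x * T ∈ auxA n L H := by
  induction hT using Submodule.span_induction with
  | mem T hT =>
    obtain ⟨y, rfl⟩ := hT
    simp only
    rw [← auxAd_mul]
    exact auxA_Ad_mem (H.mul_mem hx y.2)
  | zero => simp
  | add a b _ _ ha hb => rw [mul_add]; exact Submodule.add_mem _ ha hb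
  | smul r a _ ha => rw [mul_smul_comm]; exact Submodule.smul_mem _ _ ha

theorem auxA_mul_Ad {n : ℕ} {L : Type*} [CommRing L] {H : Subgroup (SL n ℤ)} {x : SL n ℤ}
    (hx : x ∈ H) {T} (hT : T ∈ auxA n L H) : T * auxAd n L x ∈ auxA n L H := by
  induction hT using Submodule.span_induction with
  | mem T hT =>
    obtain ⟨y, rfl⟩ := hT
    simp only
    rw [← auxAd_mul]
    exact auxA_Ad_mem (H.mul_mem y.2 hx)
  | zero => simp
  | add a b _ _ ha hb => rw [add_mul]; exact Submodule.add_mem _ ha hb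
  | smul r a _ ha => rw [smul_mul_assoc]; exact Submodule.smul_mem _ _ ha

theorem auxad_add {n : ℕ} {L : Type*} [CommRing L] (a b : Matrix (Fin n) (Fin n) L) :
    auxad (a + b) = auxad a + auxad b := by
  ext1 d
  simp only [auxad, LinearMap.coe_mk, AddHom.coe_mk, LinearMap.add_apply]; noncomm_ring

theorem auxad_smul {n : ℕ} {L : Type*} [CommRing L] (r : L) (a : Matrix (Fin n) (Fin n) L) :
    auxad (r • a) = r • auxad a := by
  ext1 d
  simp [auxad, smul_sub]

/-- Matrices whose commutator operator is in the span of the conjugations. -/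
def auxg (n : ℕ) (L : Type*) [CommRing L] (H : Subgroup (SL n ℤ)) :
    Submodule L (Matrix (Fin n) (Fin n) L) where
  carrier := {c | auxad c ∈ auxA n L H}
  add_mem' {a b} ha hb := by
    change auxad (a + b) ∈ auxA n L H
    rw [auxad_add]; exact Submodule.add_mem _ ha hb
  zero_mem' := by
    change auxad (0 : Matrix (Fin n) (Fin n) L) ∈ auxA n L H
    have : auxad (0 : Matrix (Fin n) (Fin n) L) = 0 := by ext1 d; simp [auxad]
    rw [this]; exact Submodule.zero_mem _
  smul_mem' r a ha := by
    change auxad (r • a) ∈ auxA n L H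
    rw [auxad_smul]; exact Submodule.smul_mem _ _ ha

theorem auxg_inv {n : ℕ} {L : Type*} [CommRing L] {H : Subgroup (SL n ℤ)} {T}
    (hT : T ∈ auxA n L H) {c} (hc : c ∈ auxg n L H) : T c ∈ auxg n L H := by
  induction hT using Submodule.span_induction with
  | mem T hT =>
    obtain ⟨y, rfl⟩ := hT
    change auxad (auxAd n L (y : SL n ℤ) c) ∈ auxA n L H
    rw [auxad_Ad]
    exact auxA_mul_Ad (H.inv_mem y.2) (auxA_Ad_mul y.2 hc)
  | zero => exact Submodule.zero_mem _
  | add a b _ _ ha hb => exact Submodule.add_mem _ ha hb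
  | smul r a _ ha => exact Submodule.smul_mem _ _ ha

theorem auxg_lie {n : ℕ} {L : Type*} [CommRing L] {H : Subgroup (SL n ℤ)} {c d}
    (hc : c ∈ auxg n L H) (hd : d ∈ auxg n L H) : c * d - d * c ∈ auxg n L H :=
  auxg_inv (T := auxad c) hc hd

/-- interpolation: operators with prescribed weights -/
theorem auxG_weights {n : ℕ} {ι : Type*} [Fintype ι] [DecidableEq ι] [Nonempty ι] {L : Type*} [Field L]
    (H : Subgroup (SL n ℤ)) (h : SL n ℤ) (hh : h ∈ H) (lam : ι → L)
    (P : Matrix (Fin n) ι L) (Q : Matrix ι (Fin n) L)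
    (hPQ : P * Q = 1) (hQP : Q * P = 1) (hP : auxToL n L h * P = P * Matrix.diagonal lam)
    (hlam0 : ∀ i, lam i ≠ 0)
    (hlam : ∀ i j k l, i ≠ j → lam i * lam l = lam k * lam j → i = k ∧ j = l)
    (w : ι → ι → L) (hw : ∀ i, w i i = 0) :
    ∃ T ∈ auxA n L H, ∀ c i j, (Q * T c * P) i j = w i j * (Q * c * P) i j := by
  classical
  obtain ⟨i0⟩ := ‹Nonempty ι›
  set T := auxAd n L h with hT
  have hQ : Q * auxToL n L h = Matrix.diagonal lam * Q := by
    calc Q * auxToL n L h = Q * (auxToL n L h * P) * Q := by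
          rw [Matrix.mul_assoc, Matrix.mul_assoc, hPQ, Matrix.mul_one]
      _ = _ := by rw [hP, ← Matrix.mul_assoc, hQP, Matrix.one_mul]
  have hPinv : auxToL n L h⁻¹ * P = P * Matrix.diagonal (fun i => (lam i)⁻¹) := by
    have h1 : auxToL n L h⁻¹ * auxToL n L h = 1 := by rw [← map_mul]; simp
    have h2 : Matrix.diagonal lam * Matrix.diagonal (fun i => (lam i)⁻¹) = 1 := by
      rw [Matrix.diagonal_mul_diagonal]; simp [hlam0]
    calc auxToL n L h⁻¹ * P
        = auxToL n L h⁻¹ * (P * Matrix.diagonal lam) * Matrix.diagonal (fun i => (lam i)⁻¹) := by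
          simp only [Matrix.mul_assoc, h2, Matrix.mul_one]
      _ = _ := by rw [← hP, ← Matrix.mul_assoc, h1, Matrix.one_mul]
  have hT1 : ∀ c i j, (Q * T c * P) i j = (lam i * (lam j)⁻¹) * (Q * c * P) i j := by
    intro c i j
    have : Q * T c * P = Matrix.diagonal lam * (Q * c * P) * Matrix.diagonal (fun i => (lam i)⁻¹) := by
      calc Q * T c * P = (Q * auxToL n L h) * c * (auxToL n L h⁻¹ * P) := by
            simp only [hT, auxAd, LinearMap.coe_mk, AddHom.coe_mk, Matrix.mul_assoc]
        _ = _ := by rw [hQ, hPinv]; simp only [Matrix.mul_assoc]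
    rw [this, Matrix.mul_diagonal, Matrix.diagonal_mul]; ring
  have hTk : ∀ (k : ℕ) c i j, (Q * (T ^ k) c * P) i j = (lam i * (lam j)⁻¹) ^ k * (Q * c * P) i j := by
    intro k
    induction k with
    | zero => intro c i j; simp
    | succ k ih =>
      intro c i j
      rw [pow_succ', Module.End.mul_apply, hT1, ih]; ring
  have hTm : ∀ k : ℕ, T ^ k ∈ auxA n L H := by
    intro k
    induction k with
    | zero => rw [pow_zero, ← auxAd_one n L]; exact auxA_Ad_mem H.one_mem
    | succ k ih => rw [pow_succ]; exact auxA_mul_Ad hh ih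
  let s : Finset (ι × ι) := Finset.univ.filter fun q => q.1 ≠ q.2 ∨ q = (i0, i0)
  let v : ι × ι → L := fun q => lam q.1 * (lam q.2)⁻¹
  have hv : Set.InjOn v s := by
    have key : ∀ i j k l, i ≠ j → lam i * (lam j)⁻¹ = lam k * (lam l)⁻¹ → i = k ∧ j = l := by
      intro i j k l hij he
      apply hlam i j k l hij
      have := hlam0 j
      have := hlam0 l
      field_simp at he
      linear_combination he
    rintro ⟨i, j⟩ h1 ⟨k, l⟩ h2 h12
    simp only [s, Finset.coe_filter, Finset.mem_univ, true_and, Set.mem_setOf_eq, Prod.mk.injEq] at h1 h2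
    simp only [v] at h12
    rcases h1 with h1 | h1
    · obtain ⟨rfl, rfl⟩ := key i j k l h1 h12; rfl
    · rcases h2 with h2 | h2
      · obtain ⟨rfl, rfl⟩ := key k l i j h2 h12.symm; rfl
      · rw [h1.1, h1.2, h2.1, h2.2]
  let f := Lagrange.interpolate s v (fun q => w q.1 q.2)
  have hf : ∀ i j, f.eval (lam i * (lam j)⁻¹) = w i j := by
    intro i j
    by_cases hij : i = j
    · subst hij
      have := Lagrange.eval_interpolate_at_node (fun q : ι × ι => w q.1 q.2) hv
        (i := (i0, i0)) (by simp [s])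
      simp only [v] at this
      rw [mul_inv_cancel₀ (hlam0 i0)] at this
      rw [mul_inv_cancel₀ (hlam0 i), this, hw, hw]
    · exact Lagrange.eval_interpolate_at_node (fun q : ι × ι => w q.1 q.2) hv
        (i := (i, j)) (by simp [s, hij])
  refine ⟨Polynomial.aeval T f, ?_, ?_⟩
  · rw [Polynomial.aeval_eq_sum_range]
    exact Submodule.sum_mem _ fun k _ => Submodule.smul_mem _ _ (hTm k)
  · intro c i j
    rw [← hf, Polynomial.aeval_eq_sum_range, Polynomial.eval_eq_sum_range, LinearMap.sum_apply,
      Matrix.mul_sum, Matrix.sum_mul, Matrix.sum_apply, Finset.sum_mul]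
    apply Finset.sum_congr rfl
    intro k _
    rw [LinearMap.smul_apply, Matrix.mul_smul, Matrix.smul_mul, Matrix.smul_apply, hTk, smul_eq_mul,
      mul_assoc]

end PartG


section PartG2

theorem auxG_shift {n : ℕ} {L : Type*} [CommRing L] {H : Subgroup (SL n ℤ)} (s : L →+* L) {T}
    (hT : T ∈ auxA n L H) : ∃ T' ∈ auxA n L H, ∀ d, T' (d.map s) = (T d).map s := by
  induction hT using Submodule.span_induction with
  | mem T hT =>
    obtain ⟨y, rfl⟩ := hT
    refine ⟨_, auxA_Ad_mem y.2, fun d => ?_⟩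
    have h1 : ∀ x : SL n ℤ, (auxToL n L x).map s = auxToL n L x := by
      intro x; ext i j; simp [auxToL]
    simp only [auxAd, LinearMap.coe_mk, AddHom.coe_mk, Matrix.map_mul, h1]
  | zero => exact ⟨0, Submodule.zero_mem _, fun d => by ext; simp⟩
  | add a b _ _ ha hb =>
    obtain ⟨a', ha', ha⟩ := ha
    obtain ⟨b', hb', hb⟩ := hb
    refine ⟨_, Submodule.add_mem _ ha' hb', fun d => ?_⟩
    rw [LinearMap.add_apply, ha, hb]; ext; simp
  | smul r a _ ha =>
    obtain ⟨a', ha', ha⟩ := ha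
    refine ⟨_, Submodule.smul_mem _ (s r) ha', fun d => ?_⟩
    rw [LinearMap.smul_apply, ha]; ext; simp

theorem auxg_shift {n : ℕ} {L : Type*} [CommRing L] {H : Subgroup (SL n ℤ)} (s : L →+* L) {c}
    (hc : c ∈ auxg n L H) : c.map s ∈ auxg n L H := by
  obtain ⟨T, hT, hT'⟩ := auxG_shift s hc
  change auxad (c.map s) ∈ auxA n L H
  have : auxad (c.map s) = T := by
    apply Matrix.ext_linearMap
    intro i j
    apply LinearMap.ext_ring
    have h1 : (Matrix.single i j (1 : L)).map s = Matrix.single i j 1 := by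
      rw [Matrix.map_single, map_one]
    have h2 := hT' (Matrix.single i j (1 : L))
    rw [h1] at h2
    simp only [LinearMap.comp_apply, Matrix.singleLinearMap_apply, h2]
    simp only [auxad, LinearMap.coe_mk, AddHom.coe_mk]
    rw [Matrix.map_sub, Matrix.map_mul, Matrix.map_mul, h1]
    intro a b; exact map_sub s a b
  rw [this]; exact hT

theorem auxG_top (n : ℕ) (hn : n.Prime) (hodd : Odd n) (H : Subgroup (SL n ℤ)) (h : SL n ℤ)
    (hh : h ∈ H) (hirr : Irreducible (matQ h).charpoly) (hns : ¬ SolvableByFinite H) :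
    ∃ (L : Type) (_ : Field L) (_ : Algebra ℚ L), auxg n L H = ⊤ := by
  have : NeZero n := ⟨hn.ne_zero⟩
  have : Fact n.Prime := ⟨hn⟩
  obtain ⟨L, _, _, s, lam, P, Q, hPQ, hQP, hP, hlam0, hlam1, hlam2, hs⟩ := auxF_main n hn hodd h hirr
  have : CharZero L := algebraRat.charZero L
  refine ⟨L, inferInstance, inferInstance, ?_⟩
  have hP' : auxToL n L h * P = P * Matrix.diagonal lam := hP
  have hW := fun w hw => auxG_weights H h hh lam P Q hPQ hQP hP' hlam0 hlam2 w hw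
  have hrec : ∀ c d : Matrix (Fin n) (Fin n) L, Q * c * P = Q * d * P → c = d := by
    intro c d hcd
    have h1 : ∀ c : Matrix (Fin n) (Fin n) L, P * (Q * c * P) * Q = c := by
      intro c
      calc P * (Q * c * P) * Q = (P * Q) * c * (P * Q) := by simp only [Matrix.mul_assoc]
        _ = c := by rw [hPQ]; simp
    rw [← h1 c, hcd, h1]
  have hin : ∀ x : Matrix (ZMod n) (ZMod n) L, Q * (P * x * Q) * P = x := by
    intro x
    calc Q * (P * x * Q) * P = (Q * P) * x * (Q * P) := by simp only [Matrix.mul_assoc]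
      _ = x := by rw [hQP]; simp
  have hmulc : ∀ x y : Matrix (ZMod n) (ZMod n) L, P * x * Q * (P * y * Q) = P * (x * y) * Q := by
    intro x y
    calc P * x * Q * (P * y * Q) = P * x * (Q * P) * y * Q := by simp only [Matrix.mul_assoc]
      _ = _ := by rw [hQP]; simp only [Matrix.mul_assoc, Matrix.one_mul]
  have hmul : ∀ c d : Matrix (Fin n) (Fin n) L, Q * (c * d) * P = (Q * c * P) * (Q * d * P) := by
    intro c d
    calc Q * (c * d) * P = Q * c * (1 : Matrix (Fin n) (Fin n) L) * d * P := by
          simp only [Matrix.mul_assoc, Matrix.one_mul]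
      _ = _ := by rw [← hPQ]; simp only [Matrix.mul_assoc]
  have hdiag : ∀ δ : ZMod n → L, P * Matrix.diagonal δ * Q ∈ auxg n L H := by
    intro δ
    obtain ⟨T, hT, hTw⟩ := hW (fun i j => δ i - δ j) (by simp)
    change auxad (P * Matrix.diagonal δ * Q) ∈ auxA n L H
    have : auxad (P * Matrix.diagonal δ * Q) = T := by
      ext1 c
      apply hrec
      ext i j
      rw [hTw]
      simp only [auxad, LinearMap.coe_mk, AddHom.coe_mk]
      rw [Matrix.mul_sub, Matrix.sub_mul, hmul, hmul, hin, Matrix.sub_apply, Matrix.diagonal_mul,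
        Matrix.mul_diagonal]
      ring
    rw [this]; exact hT
  have hoff : ∀ c ∈ auxg n L H, ∀ i j, i ≠ j → (Q * c * P) i j ≠ 0 →
      P * (Matrix.single i j (1 : L) : Matrix (ZMod n) (ZMod n) L) * Q ∈ auxg n L H := by
    intro c hc i j hij hne
    obtain ⟨T, hT, hTw⟩ := hW (fun k l => if k = i ∧ l = j then ((Q * c * P) i j)⁻¹ else 0) (by
      intro k; rw [if_neg]; rintro ⟨rfl, rfl⟩; exact hij rfl)
    have : P * (Matrix.single i j (1 : L) : Matrix (ZMod n) (ZMod n) L) * Q = T c := by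
      apply hrec
      rw [hin]
      ext k l
      rw [hTw, Matrix.single_apply]
      by_cases hkl : k = i ∧ l = j
      · obtain ⟨rfl, rfl⟩ := hkl; simp [hne]
      · rw [if_neg hkl, if_neg (by rintro ⟨rfl, rfl⟩; exact hkl ⟨rfl, rfl⟩)]; simp
    rw [this]; exact auxg_inv hT hc
  have hrefl : ∀ i, P * (Matrix.single i i (1 : L) : Matrix (ZMod n) (ZMod n) L) * Q ∈ auxg n L H := by
    intro i
    have := hdiag (Pi.single i 1)
    rwa [Matrix.diagonal_single] at this
  have htrans : ∀ i j k, P * (Matrix.single i j (1 : L) : Matrix (ZMod n) (ZMod n) L) * Q ∈ auxg n L H →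
      P * (Matrix.single j k (1 : L) : Matrix (ZMod n) (ZMod n) L) * Q ∈ auxg n L H → P * (Matrix.single i k (1 : L) : Matrix (ZMod n) (ZMod n) L) * Q ∈ auxg n L H := by
    intro i j k h1 h2
    by_cases hik : i = k
    · subst hik; exact hrefl i
    · have h3 := auxg_lie h1 h2
      rw [hmulc, hmulc, Matrix.single_mul_single_same,
        Matrix.single_mul_single_of_ne _ _ _ _ (Ne.symm hik)] at h3
      simpa using h3
  have hPs : P.map s = P.submatrix id (fun i => i + 1) := by
    ext r i; simp [hs]
  have hQs : Q.map s = Q.submatrix (fun i => i + 1) id := by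
    have e1 : P.map s * Q.map s = 1 := by
      rw [← Matrix.map_mul, hPQ, Matrix.map_one] <;> simp
    have e2 : Q.submatrix (fun i : ZMod n => i + 1) id * P.map s = 1 := by
      rw [hPs]
      have := Matrix.submatrix_mul Q P (fun i : ZMod n => i + 1) id (fun i => i + 1) Function.bijective_id
      rw [← this, hQP]
      ext i j
      simp [Matrix.one_apply]
    calc Q.map s = (Q.submatrix (fun i : ZMod n => i + 1) id * P.map s) * Q.map s := by
          rw [e2, Matrix.one_mul]
      _ = _ := by rw [Matrix.mul_assoc, e1, Matrix.mul_one]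
  have hsh : ∀ i j, P * (Matrix.single i j (1 : L) : Matrix (ZMod n) (ZMod n) L) * Q ∈ auxg n L H →
      P * (Matrix.single (i + 1) (j + 1) (1 : L) : Matrix (ZMod n) (ZMod n) L) * Q ∈ auxg n L H := by
    intro i j hm
    have h1 := auxg_shift s hm
    have : (P * (Matrix.single i j (1 : L) : Matrix (ZMod n) (ZMod n) L) * Q).map s = P * (Matrix.single (i + 1) (j + 1) (1 : L) : Matrix (ZMod n) (ZMod n) L) * Q := by
      rw [Matrix.map_mul, Matrix.map_mul, Matrix.map_single, map_one, hPs, hQs]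
      ext a b
      rw [Matrix.mul_apply, Matrix.mul_apply]
      rw [Finset.sum_eq_single j, Finset.sum_eq_single (j + 1)]
      · simp
      · intro x _ hx; simp [Matrix.mul_single_apply_of_ne, hx]
      · simp
      · intro x _ hx; simp [Matrix.mul_single_apply_of_ne, hx]
      · simp
    rw [← this]; exact h1
  -- some off-diagonal pair
  have hex : ∃ i j : ZMod n, i ≠ j ∧ P * (Matrix.single i j (1 : L) : Matrix (ZMod n) (ZMod n) L) * Q ∈ auxg n L H := by
    by_contra hcon
    push Not at hcon
    apply hns
    refine auxS H h hh lam P Q hPQ hQP hP' 1 (hlam1 1 one_pos) ?_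
    intro x hx
    rw [pow_one]
    have hφ : auxToL n L h = P * Matrix.diagonal lam * Q := by
      rw [← hP', Matrix.mul_assoc, hPQ, Matrix.mul_one]
    have hc : auxToL n L (x * h * x⁻¹) ∈ auxg n L H := by
      have h1 := auxg_inv (auxA_Ad_mem hx) (hdiag lam)
      rw [← hφ] at h1
      simpa [auxAd] using h1
    set c := auxToL n L (x * h * x⁻¹) with hcdef
    have hd : Q * c * P = Matrix.diagonal (fun i => (Q * c * P) i i) := by
      ext i j
      by_cases hij : i = j
      · subst hij; simp
      · rw [Matrix.diagonal_apply_ne _ hij]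
        by_contra hne
        exact hcon i j hij (hoff c hc i j hij hne)
    apply auxToL_inj n L
    rw [map_mul, map_mul (auxToL n L) h, ← hcdef]
    apply hrec
    rw [hmul, hmul, hd, hφ, hin, Matrix.diagonal_mul_diagonal, Matrix.diagonal_mul_diagonal]
    congr 1; ext i; ring
  obtain ⟨i0, j0, hij, hS⟩ := hex
  have hk : ∀ k : ℕ, P * (Matrix.single (i0 + k) (j0 + k) (1 : L) : Matrix (ZMod n) (ZMod n) L) * Q ∈ auxg n L H := by
    intro k
    induction k with
    | zero => simpa using hS
    | succ k ih => have := hsh _ _ ih; push_cast; rwa [← add_assoc, ← add_assoc]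
  have hδ : ∀ i : ZMod n, P * (Matrix.single i (i + (j0 - i0)) (1 : L) : Matrix (ZMod n) (ZMod n) L) * Q ∈ auxg n L H := by
    intro i
    have := hk (i - i0).val
    rw [ZMod.natCast_zmod_val] at this
    convert this using 4 <;> ring
  have hm : ∀ (m : ℕ) (i : ZMod n), P * (Matrix.single i (i + m * (j0 - i0)) (1 : L) : Matrix (ZMod n) (ZMod n) L) * Q ∈ auxg n L H := by
    intro m
    induction m with
    | zero => intro i; simpa using hrefl i
    | succ m ih =>
      intro i
      have := htrans _ _ _ (ih i) (hδ _)
      convert this using 4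
      push_cast; ring
  have hall : ∀ i j, P * (Matrix.single i j (1 : L) : Matrix (ZMod n) (ZMod n) L) * Q ∈ auxg n L H := by
    intro i j
    have hne : j0 - i0 ≠ 0 := sub_ne_zero.2 (Ne.symm hij)
    have := hm ((j - i) / (j0 - i0)).val i
    rw [ZMod.natCast_zmod_val, div_mul_cancel₀ _ hne] at this
    simpa using this
  rw [eq_top_iff]
  intro c _
  have : c = ∑ i, ∑ j, (Q * c * P) i j • (P * (Matrix.single i j (1 : L) : Matrix (ZMod n) (ZMod n) L) * Q) := by
    apply hrec
    simp only [Matrix.mul_sum, Matrix.sum_mul, Matrix.mul_smul, Matrix.smul_mul, hin]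
    conv_lhs => rw [Matrix.matrix_eq_sum_single (Q * c * P)]
    simp [Matrix.smul_single]
  rw [this]
  exact Submodule.sum_mem _ fun i _ => Submodule.sum_mem _ fun j _ => Submodule.smul_mem _ _ (hall i j)

theorem auxG_desc {n : ℕ} {L : Type*} [Field L] [Algebra ℚ L] {H : Subgroup (SL n ℤ)} {T}
    (hT : T ∈ auxA n L H) : ∀ r : L →ₗ[ℚ] ℚ, ∃ m : ℤ, m ≠ 0 ∧ ∃ U ∈ auxA n ℤ H,
      ∀ (c : Matrix (Fin n) (Fin n) ℤ) i j,
        ((U c i j : ℤ) : ℚ) = m * r (T (c.map (Int.castRingHom L)) i j) := by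
  induction hT using Submodule.span_induction with
  | mem T hT =>
    obtain ⟨y, rfl⟩ := hT
    intro r
    refine ⟨(r 1).den, by simp, (r 1).num • auxAd n ℤ (y : SL n ℤ),
      Submodule.smul_mem _ _ (auxA_Ad_mem y.2), fun c i j => ?_⟩
    have h1 : ∀ x : SL n ℤ, auxToL n L x = (auxToL n ℤ x).map (Int.castRingHom L) := by
      intro x; ext i j; simp [auxToL]
    have h2 : auxAd n L (y : SL n ℤ) (c.map (Int.castRingHom L))
        = (auxAd n ℤ (y : SL n ℤ) c).map (Int.castRingHom L) := by
      simp only [auxAd, LinearMap.coe_mk, AddHom.coe_mk, Matrix.map_mul, h1]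
    have h3 : ∀ z : ℤ, r (z : L) = z * r 1 := by
      intro z
      have : (z : L) = (z : ℚ) • (1 : L) := by rw [Algebra.smul_def]; simp
      rw [this, map_smul, smul_eq_mul]
    simp only [h2, Matrix.map_apply, LinearMap.smul_apply, Matrix.smul_apply, eq_intCast, h3]
    rw [smul_eq_mul, Int.cast_mul]
    have := Rat.mul_den_eq_num (r 1)
    push_cast
    rw [← this]; ring
  | zero => intro r; exact ⟨1, one_ne_zero, 0, Submodule.zero_mem _, fun c i j => by simp⟩
  | add a b _ _ ha hb =>
    intro r
    obtain ⟨m, hm, U, hU, hUc⟩ := ha r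
    obtain ⟨m', hm', U', hU', hUc'⟩ := hb r
    refine ⟨m * m', mul_ne_zero hm hm', m' • U + m • U', Submodule.add_mem _
      (Submodule.smul_mem _ _ hU) (Submodule.smul_mem _ _ hU'), fun c i j => ?_⟩
    simp only [LinearMap.add_apply, LinearMap.smul_apply, Matrix.add_apply, Matrix.smul_apply,
      smul_eq_mul, Int.cast_add, Int.cast_mul, hUc, hUc', map_add]
    ring
  | smul t a _ ha =>
    intro r
    obtain ⟨m, hm, U, hU, hUc⟩ := ha (r ∘ₗ LinearMap.mulLeft ℚ t)
    refine ⟨m, hm, U, hU, fun c i j => ?_⟩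
    rw [hUc]; simp

theorem auxG_modp {n p : ℕ} {H : Subgroup (SL n ℤ)} {U} (hU : U ∈ auxA n ℤ H)
    (W : Submodule (ZMod p) (Matrix (Fin n) (Fin n) (ZMod p)))
    (hW : ∀ g ∈ H.map (redMod n p), ∀ c ∈ W,
      (g : Matrix (Fin n) (Fin n) (ZMod p)) * c * ((g⁻¹ : SL n (ZMod p)) : Matrix _ _ _) ∈ W) :
    ∀ c : Matrix (Fin n) (Fin n) ℤ, c.map (Int.castRingHom (ZMod p)) ∈ W →
      (U c).map (Int.castRingHom (ZMod p)) ∈ W := by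
  induction hU using Submodule.span_induction with
  | mem T hT =>
    obtain ⟨y, rfl⟩ := hT
    intro c hc
    have := hW _ ⟨y, y.2, rfl⟩ _ hc
    rw [← map_inv] at this
    convert this using 1
    simp only [auxAd, LinearMap.coe_mk, AddHom.coe_mk, Matrix.map_mul]
    have h1 : ∀ x : SL n ℤ, (auxToL n ℤ x).map (Int.castRingHom (ZMod p))
        = ((redMod n p x : SL n (ZMod p)) : Matrix _ _ _) := by
      intro x; ext i j; simp [auxToL, redMod]
    rw [h1, h1]
  | zero => intro c _; convert W.zero_mem; ext; simp
  | add a b _ _ ha hb =>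
    intro c hc
    convert W.add_mem (ha c hc) (hb c hc) using 1
    ext; simp
  | smul t a _ ha =>
    intro c hc
    convert W.smul_mem (t : ZMod p) (ha c hc) using 1
    ext i j
    simp only [LinearMap.smul_apply, Matrix.map_apply, Matrix.smul_apply, eq_intCast, smul_eq_mul,
      Int.cast_mul]

theorem auxG_final (n : ℕ) (hn : n.Prime) (hodd : Odd n) (H : Subgroup (SL n ℤ)) (h : SL n ℤ)
    (hh : h ∈ H) (hirr : Irreducible (matQ h).charpoly) (hns : ¬ SolvableByFinite H) :
    ∃ B : ℕ, ∀ p : ℕ, p.Prime → B < p →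
      ∀ W : Submodule (ZMod p) (Matrix (Fin n) (Fin n) (ZMod p)),
      (∀ g ∈ H.map (redMod n p), ∀ c ∈ W,
      (g : Matrix (Fin n) (Fin n) (ZMod p)) * c * ((g⁻¹ : SL n (ZMod p)) : Matrix _ _ _) ∈ W) →
      ∀ a b c, c ∈ W → Matrix.single a b 1 * c - c * Matrix.single a b 1 ∈ W := by
  obtain ⟨L, _, _, hL⟩ := auxG_top n hn hodd H h hh hirr hns
  have : CharZero L := algebraRat.charZero L
  obtain ⟨r, hr⟩ := (Algebra.linearMap ℚ L).exists_leftInverse_of_injective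
    (LinearMap.ker_eq_bot.2 (algebraMap ℚ L).injective)
  have hr' : ∀ z : ℤ, r (z : L) = z := by
    intro z
    have := LinearMap.congr_fun hr (z : ℚ)
    simpa using this
  have key : ∀ q : Fin n × Fin n, ∃ m : ℤ, m ≠ 0 ∧ ∃ U ∈ auxA n ℤ H,
      ∀ c : Matrix (Fin n) (Fin n) ℤ, U c = m • (Matrix.single q.1 q.2 1 * c - c * Matrix.single q.1 q.2 1) := by
    rintro ⟨a, b⟩
    have hab : auxad (Matrix.single a b (1 : L)) ∈ auxA n L H := by
      have : Matrix.single a b (1 : L) ∈ auxg n L H := by rw [hL]; trivial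
      exact this
    obtain ⟨m, hm, U, hU, hUc⟩ := auxG_desc hab r
    refine ⟨m, hm, U, hU, fun c => ?_⟩
    ext i j
    have h1 := hUc c i j
    have h2 : auxad (Matrix.single a b (1 : L)) (c.map (Int.castRingHom L))
        = (Matrix.single a b 1 * c - c * Matrix.single a b 1).map (Int.castRingHom L) := by
      simp only [auxad, LinearMap.coe_mk, AddHom.coe_mk]
      rw [Matrix.map_sub, Matrix.map_mul, Matrix.map_mul, Matrix.map_single, map_one]
      intro a b; exact map_sub _ a b
    rw [h2, Matrix.map_apply, eq_intCast, hr'] at h1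
    rw [Matrix.smul_apply, smul_eq_mul]
    exact_mod_cast h1
  choose m hm U hU hUc using key
  refine ⟨∑ q, (m q).natAbs, fun p hp hBp W hW a b c hc => ?_⟩
  have : Fact p.Prime := ⟨hp⟩
  have hmp : ((m (a, b) : ℤ) : ZMod p) ≠ 0 := by
    rw [Ne, ZMod.intCast_zmod_eq_zero_iff_dvd]
    intro hd
    have h1 := Nat.le_of_dvd (Int.natAbs_pos.2 (hm (a, b))) (Int.natCast_dvd.1 hd)
    have h2 := Finset.single_le_sum (f := fun q => (m q).natAbs) (fun _ _ => Nat.zero_le _)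
      (Finset.mem_univ (a, b))
    have h3 : (m (a, b)).natAbs ≤ ∑ q, (m q).natAbs := h2
    omega
  obtain ⟨c', rfl⟩ : ∃ c' : Matrix (Fin n) (Fin n) ℤ, c'.map (Int.castRingHom (ZMod p)) = c := by
    refine ⟨c.map (fun x => (x.val : ℤ)), ?_⟩
    ext i j; simp
  have h1 := auxG_modp (hU (a, b)) W hW c' hc
  rw [hUc] at h1
  have h2 := W.smul_mem ((m (a, b) : ZMod p)⁻¹) h1
  convert h2 using 1
  have h3 : (Matrix.single a b (1 : ZMod p)) = (Matrix.single a b (1 : ℤ)).map (Int.castRingHom (ZMod p)) := by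
    rw [Matrix.map_single, map_one]
  rw [h3, ← Matrix.map_mul, ← Matrix.map_mul]
  ext i j
  simp only [Matrix.sub_apply, Matrix.map_apply, Matrix.smul_apply, eq_intCast, smul_eq_mul]
  push_cast
  rw [← mul_assoc, inv_mul_cancel₀ hmp, one_mul]

end PartG2


section PartK

theorem auxK_off {n : ℕ} {F : Type*} [Field F] (h2 : (2 : F) ≠ 0)
    (W : Submodule F (Matrix (Fin n) (Fin n) F))
    (hW : ∀ a b c, c ∈ W → Matrix.single a b 1 * c - c * Matrix.single a b 1 ∈ W)
    (c : Matrix (Fin n) (Fin n) F) (hc : c ∈ W) (a b : Fin n) (hab : a ≠ b) (hne : c b a ≠ 0) :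
    Matrix.single a b 1 ∈ W := by
  have h1 := hW a b _ (hW a b c hc)
  have h3 : Matrix.single a b 1 * (Matrix.single a b 1 * c - c * Matrix.single a b 1)
      - (Matrix.single a b 1 * c - c * Matrix.single a b 1) * Matrix.single a b 1
      = (-2 * c b a) • Matrix.single a b (1 : F) := by
    have e1 : Matrix.single a b (1 : F) * Matrix.single a b 1 = 0 :=
      Matrix.single_mul_single_of_ne _ _ _ _ (Ne.symm hab)  _
    have e2 : Matrix.single a b (1 : F) * c * Matrix.single a b 1 = c b a • Matrix.single a b (1 : F) := by
      rw [Matrix.single_mul_mul_single]; simp [Matrix.smul_single]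
    calc _ = (Matrix.single a b (1 : F) * Matrix.single a b 1) * c
          - (2 : F) • (Matrix.single a b (1 : F) * c * Matrix.single a b 1)
          + c * (Matrix.single a b (1 : F) * Matrix.single a b 1) := by
          rw [two_smul]; noncomm_ring
      _ = _ := by rw [e1, e2, smul_smul, neg_mul, neg_smul]; simp
  rw [h3] at h1
  have h4 : (-2 * c b a) ≠ 0 := mul_ne_zero (neg_ne_zero.2 h2) hne
  have := W.smul_mem (-2 * c b a)⁻¹ h1
  rwa [smul_smul, inv_mul_cancel₀ h4, one_smul] at this

theorem auxK_main {n : ℕ} {F : Type*} [Field F] (h2 : (2 : F) ≠ 0)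
    (W : Submodule F (Matrix (Fin n) (Fin n) F))
    (hW : ∀ a b c, c ∈ W → Matrix.single a b 1 * c - c * Matrix.single a b 1 ∈ W)
    (c : Matrix (Fin n) (Fin n) F) (hc : c ∈ W) (hns : ∀ z : F, c ≠ z • 1) :
    LinearMap.ker (Matrix.traceLinearMap (Fin n) F F) ≤ W := by
  have hoff := auxK_off h2 W hW
  have hex : ∃ a b, a ≠ b ∧ Matrix.single a b (1 : F) ∈ W := by
    by_cases h : ∃ a b, a ≠ b ∧ c b a ≠ 0
    · obtain ⟨a, b, hab, hne⟩ := h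
      exact ⟨a, b, hab, hoff c hc a b hab hne⟩
    · push Not at h
      have hex : ∃ a b, c a a ≠ c b b := by
        by_contra hcon
        push Not at hcon
        rcases isEmpty_or_nonempty (Fin n) with he | ⟨⟨i0⟩⟩
        · exact hns 0 (Subsingleton.elim _ _)
        · apply hns (c i0 i0)
          ext i j
          by_cases hij : i = j
          · subst hij; simp [hcon i i0]
          · simp [hij, h j i (Ne.symm hij)]
      obtain ⟨a, b, hab⟩ := hex
      have hne : a ≠ b := by rintro rfl; exact hab rfl
      refine ⟨a, b, hne, ?_⟩
      have h1 := hW a b c hc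
      have h3 : Matrix.single a b 1 * c - c * Matrix.single a b 1
          = (c b b - c a a) • Matrix.single a b (1 : F) := by
        ext i j
        rw [Matrix.sub_apply, Matrix.smul_apply]
        by_cases hi : i = a
        · subst hi
          rw [Matrix.single_mul_apply_same]
          by_cases hj : j = b
          · subst hj; simp
          · rw [Matrix.mul_single_apply_of_ne _ _ _ _ _ hj, h j b hj]
            simp [Ne.symm hj]
        · rw [Matrix.single_mul_apply_of_ne _ _ _ _ _ hi]
          by_cases hj : j = b
          · subst hj; simp [h a i (Ne.symm hi), Ne.symm hi]
          · rw [Matrix.mul_single_apply_of_ne _ _ _ _ _ hj]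
            simp [Ne.symm hj]
      rw [h3] at h1
      have h4 : c b b - c a a ≠ 0 := sub_ne_zero.2 (Ne.symm hab)
      have := W.smul_mem (c b b - c a a)⁻¹ h1
      rwa [smul_smul, inv_mul_cancel₀ h4, one_smul] at this
  have hswap : ∀ a b, a ≠ b → Matrix.single a b (1 : F) ∈ W → Matrix.single b a (1 : F) ∈ W := by
    intro a b hab hm
    exact hoff _ hm b a hab.symm (by simp)
  have hrow : ∀ a b k, a ≠ b → k ≠ b → Matrix.single a b (1 : F) ∈ W → Matrix.single k b (1 : F) ∈ W := by
    intro a b k hab hkb hm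
    have := hW k a _ hm
    rw [Matrix.single_mul_single_same, Matrix.single_mul_single_of_ne _ _ _ _ hkb.symm] at this
    simpa using this
  have hcol : ∀ a b k, a ≠ b → a ≠ k → Matrix.single a b (1 : F) ∈ W → Matrix.single a k (1 : F) ∈ W := by
    intro a b k hab hak hm
    exact hswap k a hak.symm (hrow b a k hab.symm hak.symm (hswap a b hab hm))
  obtain ⟨a, b, hab, hm⟩ := hex
  have hall : ∀ i j, i ≠ j → Matrix.single i j (1 : F) ∈ W := by
    intro i j hij
    by_cases hja : j = a
    · subst hja
      exact hrow b j i hab.symm hij (hswap j b hab hm)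
    · exact hrow a j i (Ne.symm hja) hij (hcol a b j hab (Ne.symm hja) hm)
  have hdiag : ∀ i, Matrix.single i i (1 : F) - Matrix.single a a 1 ∈ W := by
    intro i
    by_cases hi : i = a
    · subst hi; simp
    · have := hW i a _ (hall a i (Ne.symm hi))
      rwa [Matrix.single_mul_single_same, Matrix.single_mul_single_same, one_mul] at this
  intro x hx
  have hx' : ∑ i, x i i = 0 := hx
  have : x = ∑ i, ∑ j, (if i = j then x i i • (Matrix.single i i (1 : F) - Matrix.single a a 1)
      else x i j • Matrix.single i j 1) := by
    have h5 : ∑ i, x i i • Matrix.single a a (1 : F) = 0 := by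
      rw [← Finset.sum_smul, hx', zero_smul]
    have h6 : x = (∑ i, ∑ j, Matrix.single i j (x i j)) - ∑ i, x i i • Matrix.single a a (1 : F) := by
      rw [h5, sub_zero]; exact Matrix.matrix_eq_sum_single x
    refine h6.trans ?_
    rw [← Finset.sum_sub_distrib]
    apply Finset.sum_congr rfl
    intro i _
    have : x i i • Matrix.single a a (1 : F) = ∑ j, if i = j then x i i • Matrix.single a a (1 : F) else 0 := by
      simp
    rw [this, ← Finset.sum_sub_distrib]
    apply Finset.sum_congr rfl
    intro j _
    by_cases hij : i = j
    · subst hij; simp [smul_sub, Matrix.smul_single]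
    · simp [hij, Matrix.smul_single]
  rw [this]
  refine Submodule.sum_mem _ fun i _ => Submodule.sum_mem _ fun j _ => ?_
  split_ifs with hij
  · exact W.smul_mem _ (hdiag i)
  · exact W.smul_mem _ (hall i j hij)

theorem auxK_rank {n : ℕ} {F : Type*} [Field F]
    (W : Submodule F (Matrix (Fin n) (Fin n) F))
    (hW : LinearMap.ker (Matrix.traceLinearMap (Fin n) F F) ≤ W) :
    n ^ 2 - 1 ≤ Module.finrank F W := by
  have h1 := Submodule.finrank_mono hW
  have h2 := LinearMap.finrank_range_add_finrank_ker (Matrix.traceLinearMap (Fin n) F F)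
  have h3 : Module.finrank F (Matrix (Fin n) (Fin n) F) = n ^ 2 := by
    rw [Module.finrank_matrix]; simp [sq]
  have h4 := Submodule.finrank_le (LinearMap.range (Matrix.traceLinearMap (Fin n) F F))
  rw [Module.finrank_self] at h4
  omega

theorem auxK_card (n p : ℕ) (hn : 0 < n) (hp : p.Prime) :
    Nat.card (SL n (ZMod p)) * (p - 1) ≤ p ^ (n ^ 2) := by
  have : Fact p.Prime := ⟨hp⟩
  let i0 : Fin n := ⟨0, hn⟩
  have h1 : Nat.card (SL n (ZMod p) × (ZMod p)ˣ) ≤ Nat.card (Matrix (Fin n) (Fin n) (ZMod p)) := by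
    apply Nat.card_le_card_of_injective
      (fun q : SL n (ZMod p) × (ZMod p)ˣ =>
        Matrix.diagonal (Function.update (1 : Fin n → ZMod p) i0 q.2) * (q.1 : Matrix _ _ _))
    have hdet : ∀ a : (ZMod p)ˣ, (Matrix.diagonal (Function.update (1 : Fin n → ZMod p) i0 a)).det = a := by
      intro a
      rw [Matrix.det_diagonal, Finset.prod_update_of_mem (Finset.mem_univ _)]
      simp
    rintro ⟨g, a⟩ ⟨g', a'⟩ h
    simp only at h
    have h2 := congrArg Matrix.det h
    rw [Matrix.det_mul, Matrix.det_mul, hdet, hdet, g.2, g'.2, mul_one, mul_one] at h2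
    have h3 : a = a' := Units.ext h2
    subst h3
    have hu : IsUnit (Matrix.diagonal (Function.update (1 : Fin n → ZMod p) i0 a)) := by
      rw [Matrix.isUnit_iff_isUnit_det, hdet]; exact a.isUnit
    have h4 := hu.mul_left_cancel h
    rw [Prod.mk.injEq]
    exact ⟨Subtype.ext h4, rfl⟩
  rw [Nat.card_prod] at h1
  have h2 : Nat.card (Matrix (Fin n) (Fin n) (ZMod p)) = p ^ (n ^ 2) := by
    change Nat.card (Fin n → Fin n → ZMod p) = _
    rw [Nat.card_eq_fintype_card]; simp [ZMod.card, sq, pow_mul]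
  have h3 : Nat.card (ZMod p)ˣ = p - 1 := by
    rw [Nat.card_eq_fintype_card, ZMod.card_units]
  rwa [h2, h3] at h1

end PartK


section PartH1

theorem auxH_mul {R : Type*} [CommRing R] (I : Ideal R) {a a' b b' : R} {r s : ℕ}
    (h1 : a - a' ∈ I ^ (r + 1)) (h2 : a' ∈ I ^ r) (h3 : b - b' ∈ I ^ (s + 1)) (h4 : b' ∈ I ^ s) :
    a * b - a' * b' ∈ I ^ (r + s + 1) ∧ a' * b' ∈ I ^ (r + s) := by
  have hb : b ∈ I ^ s := by
    have := (I ^ s).add_mem (Ideal.pow_le_pow_right (Nat.le_succ s) h3) h4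
    simpa using this
  refine ⟨?_, by rw [pow_add]; exact Ideal.mul_mem_mul h2 h4⟩
  have e : a * b - a' * b' = (a - a') * b + a' * (b - b') := by ring
  rw [e]
  apply Ideal.add_mem
  · have := Ideal.mul_mem_mul h1 hb
    rwa [← pow_add, show r + 1 + s = r + s + 1 by ring] at this
  · have := Ideal.mul_mem_mul h2 h3
    rwa [← pow_add, ← add_assoc] at this

theorem auxH_pow {R : Type*} [CommRing R] (I : Ideal R) {a a' : R}
    (h1 : a - a' ∈ I ^ 2) (h2 : a' ∈ I) (k : ℕ) :
    a ^ k - a' ^ k ∈ I ^ (k + 1) ∧ a' ^ k ∈ I ^ k := by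
  induction k with
  | zero => simp
  | succ k ih =>
    rw [pow_succ a, pow_succ a']
    exact auxH_mul I (r := k) (s := 1) ih.1 ih.2 h1 (by simpa using h2)

theorem auxH_prod {R : Type*} [CommRing R] (I : Ideal R) {ι : Type*} (s : Finset ι) (a a' : ι → R)
    (h1 : ∀ i, a i - a' i ∈ I ^ 2) (h2 : ∀ i, a' i ∈ I) (k : ι → ℕ) :
    ∏ i ∈ s, a i ^ k i - ∏ i ∈ s, a' i ^ k i ∈ I ^ (∑ i ∈ s, k i + 1) ∧
      ∏ i ∈ s, a' i ^ k i ∈ I ^ (∑ i ∈ s, k i) := by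
  classical
  induction s using Finset.induction_on with
  | empty => simp
  | insert i s hi ih =>
    rw [Finset.prod_insert hi, Finset.prod_insert hi, Finset.sum_insert hi]
    have := auxH_pow I (h1 i) (h2 i) (k i)
    exact auxH_mul I this.1 this.2 ih.1 ih.2

theorem auxH_count (p : ℕ) [Fact p.Prime] (d e D : ℕ) (hD : d * D * e < p) {G : Type*} [Finite G]
    (ev : (Fin d → ZMod p) → G) (Y : Fin d → G → ZMod p)
    (y : Fin d → MvPolynomial (Fin d) (ZMod p))
    (hy : ∀ j t, MvPolynomial.eval t (y j) = Y j (ev t))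
    (hdeg : ∀ j, (y j).totalDegree ≤ e)
    (hord : ∀ j, y j - MvPolynomial.X j ∈ MvPolynomial.idealOfVars (Fin d) (ZMod p) ^ 2) :
    D ^ d ≤ Nat.card G := by
  classical
  have := Fintype.ofFinite G
  set I := MvPolynomial.idealOfVars (Fin d) (ZMod p) with hI
  have hX : ∀ j, (MvPolynomial.X j : MvPolynomial (Fin d) (ZMod p)) ∈ I := by
    intro j; exact Ideal.subset_span ⟨j, rfl⟩
  let v : (Fin d → Fin D) → G → ZMod p := fun α g => ∏ j, Y j g ^ (α j : ℕ)
  have hli : LinearIndependent (ZMod p) v := by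
    rw [Fintype.linearIndependent_iff]
    intro c hc
    set f : MvPolynomial (Fin d) (ZMod p) :=
      ∑ α : Fin d → Fin D, MvPolynomial.C (c α) * ∏ j, y j ^ (α j : ℕ) with hf
    have hf0 : f = 0 := by
      apply MvPolynomial.eq_zero_of_eval_zero_at_prod_finset f (fun _ => Finset.univ)
      · intro i
        rw [Finset.card_univ, ZMod.card]
        refine lt_of_le_of_lt (MvPolynomial.degreeOf_le_totalDegree f i) (lt_of_le_of_lt ?_ hD)
        apply MvPolynomial.totalDegree_finsetSum_le
        intro α _
        refine (MvPolynomial.totalDegree_mul _ _).trans ?_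
        rw [MvPolynomial.totalDegree_C, zero_add]
        refine (MvPolynomial.totalDegree_finset_prod _ _).trans ?_
        have : ∀ j ∈ Finset.univ, (y j ^ (α j : ℕ)).totalDegree ≤ D * e := by
          intro j _
          refine (MvPolynomial.totalDegree_pow _ _).trans ?_
          exact Nat.mul_le_mul (α j).2.le (hdeg j)
        refine (Finset.sum_le_sum this).trans ?_
        simp [mul_assoc]
      · intro t _
        have h1 := congrFun hc (ev t)
        simp only [Finset.sum_apply, Pi.smul_apply, smul_eq_mul, Pi.zero_apply, v] at h1
        rw [hf, map_sum, ← h1]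
        apply Finset.sum_congr rfl
        intro α _
        simp [hy]
    by_contra hcon
    push Not at hcon
    obtain ⟨α1, hα1⟩ := hcon
    let S : Finset (Fin d → Fin D) := Finset.univ.filter fun α => c α ≠ 0
    obtain ⟨α0, hα0, hmin⟩ := S.exists_min_image (fun α => ∑ j, (α j : ℕ)) ⟨α1, by simp [S, hα1]⟩
    have hα0' : c α0 ≠ 0 := by simpa [S] using hα0
    have hmem : ∑ α : Fin d → Fin D, MvPolynomial.C (c α) * ∏ j, MvPolynomial.X j ^ (α j : ℕ)
        ∈ I ^ (∑ j, (α0 j : ℕ) + 1) := by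
      have h1 : ∑ α : Fin d → Fin D, MvPolynomial.C (c α) * ∏ j, MvPolynomial.X j ^ (α j : ℕ)
          = - ∑ α : Fin d → Fin D, MvPolynomial.C (c α) *
            (∏ j, y j ^ (α j : ℕ) - ∏ j, MvPolynomial.X j ^ (α j : ℕ)) := by
        simp only [mul_sub, Finset.sum_sub_distrib]
        rw [← hf, hf0]; ring
      rw [h1]
      rw [neg_mem_iff]
      apply Ideal.sum_mem
      intro α _
      by_cases hα : c α = 0
      · simp [hα]
      · apply Ideal.mul_mem_left
        have := (auxH_prod I Finset.univ y (fun j => MvPolynomial.X j) hord hX (fun j => (α j : ℕ))).1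
        refine Ideal.pow_le_pow_right ?_ this
        have := hmin α (by simp [S, hα])
        omega
    rw [MvPolynomial.mem_pow_idealOfVars_iff'] at hmem
    have hfs : ∀ α : Fin d → Fin D, MvPolynomial.C (c α) * ∏ j, MvPolynomial.X j ^ (α j : ℕ)
        = MvPolynomial.monomial (Finsupp.equivFunOnFinite.symm fun j => (α j : ℕ)) (c α) := by
      intro α
      rw [MvPolynomial.monomial_eq, Finsupp.prod_fintype]
      · simp
      · simp
    have h2 := hmem (Finsupp.equivFunOnFinite.symm fun j => (α0 j : ℕ)) (by
      rw [Finsupp.degree_eq_sum]; simp)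
    simp only [hfs, MvPolynomial.coeff_sum, MvPolynomial.coeff_monomial] at h2
    rw [Finset.sum_eq_single α0] at h2
    · simp at h2; exact hα0' h2
    · intro α _ hne
      rw [if_neg]
      intro he
      apply hne
      have := Finsupp.equivFunOnFinite.symm.injective he
      funext j
      exact Fin.ext (congrFun this j)
    · simp
  have := hli.fintype_card_le_finrank
  rw [Module.finrank_fintype_fun_eq_card, Fintype.card_fun, Fintype.card_fin, Fintype.card_fin] at this
  rwa [Nat.card_eq_fintype_card]

end PartH1


section PartH2

theorem auxH_aeval_ord {F : Type*} [Field F] {d : ℕ} (i : Fin d) (b : Polynomial F) :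
    Polynomial.aeval (MvPolynomial.X i : MvPolynomial (Fin d) F) b
      - (MvPolynomial.C (b.coeff 0) + MvPolynomial.C (b.coeff 1) * MvPolynomial.X i)
      ∈ MvPolynomial.idealOfVars (Fin d) F ^ 2 := by
  have h1 : b = (b.divX.divX * Polynomial.X + Polynomial.C (b.coeff 1)) * Polynomial.X
      + Polynomial.C (b.coeff 0) := by
    have h2 := Polynomial.divX_mul_X_add b
    have h3 := Polynomial.divX_mul_X_add b.divX
    rw [Polynomial.coeff_divX] at h3
    rw [show (1 : ℕ) = 0 + 1 from rfl, h3, h2]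
  have h4 : Polynomial.aeval (MvPolynomial.X i : MvPolynomial (Fin d) F) b
      = (Polynomial.aeval (MvPolynomial.X i : MvPolynomial (Fin d) F) b.divX.divX * MvPolynomial.X i
        + MvPolynomial.C (b.coeff 1)) * MvPolynomial.X i + MvPolynomial.C (b.coeff 0) := by
    conv_lhs => rw [h1]
    simp [MvPolynomial.algebraMap_eq]
  have h5 : (MvPolynomial.X i : MvPolynomial (Fin d) F) ∈ MvPolynomial.idealOfVars (Fin d) F :=
    Ideal.subset_span ⟨i, rfl⟩
  rw [h4]
  have h6 := Ideal.mul_mem_left _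
    (Polynomial.aeval (MvPolynomial.X i : MvPolynomial (Fin d) F) b.divX.divX) (Ideal.mul_mem_mul h5 h5)
  rw [← sq] at h6
  convert h6 using 1
  ring

theorem auxH_aeval_deg {F : Type*} [Field F] {d : ℕ} (i : Fin d) (b : Polynomial F) :
    (Polynomial.aeval (MvPolynomial.X i : MvPolynomial (Fin d) F) b).totalDegree ≤ b.natDegree := by
  rw [Polynomial.aeval_eq_sum_range]
  apply MvPolynomial.totalDegree_finsetSum_le
  intro k hk
  refine (MvPolynomial.totalDegree_smul_le _ _).trans ?_
  rw [MvPolynomial.totalDegree_X_pow]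
  exact Nat.lt_succ_iff.1 (Finset.mem_range.1 hk)

theorem auxH_list_deg {F : Type*} [Field F] {d n e : ℕ}
    (l : List (Matrix (Fin n) (Fin n) (MvPolynomial (Fin d) F)))
    (hl : ∀ A ∈ l, ∀ a b, (A a b).totalDegree ≤ e) :
    ∀ a b, (l.prod a b).totalDegree ≤ l.length * e := by
  induction l with
  | nil =>
    intro a b
    rw [List.prod_nil, Matrix.one_apply]
    split_ifs <;> simp
  | cons A l ih =>
    intro a b
    rw [List.prod_cons, Matrix.mul_apply]
    apply MvPolynomial.totalDegree_finsetSum_le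
    intro c _
    refine (MvPolynomial.totalDegree_mul _ _).trans ?_
    have h1 := hl A (by simp) a c
    have h2 := ih (fun B hB => hl B (by simp [hB])) c b
    rw [List.length_cons]
    linarith [add_mul l.length 1 e]

theorem auxH_list_ord {Q : Type*} [CommRing Q] {n : ℕ} {ι : Type*} (x : ι → Q)
    (hx : ∀ i j, x i * x j = 0) (N : ι → Matrix (Fin n) (Fin n) Q) (l : List ι) :
    (l.map fun i => 1 + x i • N i).prod = 1 + (l.map fun i => x i • N i).sum := by
  induction l with
  | nil => simp
  | cons i l ih =>
    rw [List.map_cons, List.prod_cons, ih, List.map_cons, List.sum_cons]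
    have : x i • N i * (l.map fun i => x i • N i).sum = 0 := by
      rw [← List.sum_map_mul_left]
      apply List.sum_eq_zero
      intro y hy
      simp only [List.mem_map] at hy
      obtain ⟨j, -, rfl⟩ := hy
      rw [smul_mul_smul_comm, hx, zero_smul]
    rw [add_mul, one_mul, mul_add (x i • N i), this, mul_one, add_zero]
    abel

theorem auxH_lin {F : Type*} [Field F] {n : ℕ} (l : Matrix (Fin n) (Fin n) F →ₗ[F] F)
    (M : Matrix (Fin n) (Fin n) F) : l M = ∑ a, ∑ b, l (Matrix.single a b 1) * M a b := by
  conv_lhs => rw [Matrix.matrix_eq_sum_single M]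
  simp only [map_sum]
  refine Finset.sum_congr rfl fun a _ => Finset.sum_congr rfl fun b _ => ?_
  have : Matrix.single a b (M a b) = M a b • Matrix.single a b (1 : F) := by
    simp [Matrix.smul_single]
  rw [this, map_smul, smul_eq_mul, mul_comm]

/-- binomial polynomials -/
noncomputable def auxbin (F : Type*) [Field F] (k : ℕ) : Polynomial F :=
  Polynomial.C ((k.factorial : F)⁻¹) * descPochhammer F k

theorem auxbin_eval (p : ℕ) [Fact p.Prime] (k : ℕ) (hk : k < p) (m : ℕ) :
    (auxbin (ZMod p) k).eval (m : ZMod p) = (m.choose k : ZMod p) := by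
  have hk0 : (k.factorial : ZMod p) ≠ 0 := by
    rw [Ne, ZMod.natCast_eq_zero_iff, (Fact.out : p.Prime).dvd_factorial]
    omega
  rw [auxbin, Polynomial.eval_mul, Polynomial.eval_C, descPochhammer_eval_eq_descFactorial,
    Nat.descFactorial_eq_factorial_mul_choose, Nat.cast_mul, ← mul_assoc, inv_mul_cancel₀ hk0, one_mul]

theorem auxbin_deg (F : Type*) [Field F] (k : ℕ) : (auxbin F k).natDegree ≤ k := by
  rw [auxbin]
  refine (Polynomial.natDegree_C_mul_le _ _).trans ?_
  rw [descPochhammer_natDegree]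

theorem auxH_build (n p d D : ℕ) [Fact p.Prime] (hn : 0 < n) (hnp : n < p)
    (hD : d * D * (d * n) < p)
    (G : Subgroup (SL n (ZMod p)))
    (M : Fin d → ℕ → Matrix (Fin n) (Fin n) (ZMod p))
    (hM0 : ∀ i, M i 0 = 1)
    (hMG : ∀ i (m : ℕ), ∃ x ∈ G, (x : Matrix (Fin n) (Fin n) (ZMod p)) =
      ∑ k ∈ Finset.range n, (m.choose k : ZMod p) • M i k)
    (hli : LinearIndependent (ZMod p)
      fun i => ∑ k ∈ Finset.range n, (auxbin (ZMod p) k).coeff 1 • M i k) :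
    D ^ d ≤ Nat.card G := by
  set I := MvPolynomial.idealOfVars (Fin d) (ZMod p) with hI
  set N : Fin d → Matrix (Fin n) (Fin n) (ZMod p) :=
    fun i => ∑ k ∈ Finset.range n, (auxbin (ZMod p) k).coeff 1 • M i k with hN
  -- dual functionals
  obtain ⟨ρ, hρ⟩ := (Fintype.linearCombination (ZMod p) N).exists_leftInverse_of_injective
    (LinearMap.ker_eq_bot.2 hli.fintypeLinearCombination_injective)
  let l : Fin d → Matrix (Fin n) (Fin n) (ZMod p) →ₗ[(ZMod p)] (ZMod p) := fun j => LinearMap.proj j ∘ₗ ρ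
  have hl : ∀ i j, l j (N i) = if j = i then 1 else 0 := by
    intro i j
    have h1 := LinearMap.congr_fun hρ (Pi.single i 1)
    simp only [LinearMap.comp_apply, Fintype.linearCombination_apply_single, one_smul,
      LinearMap.id_apply] at h1
    simp only [l, LinearMap.comp_apply, h1, LinearMap.proj_apply, Pi.single_apply]
  let A : Fin d → Matrix (Fin n) (Fin n) (MvPolynomial (Fin d) (ZMod p)) := fun i =>
    ∑ k ∈ Finset.range n, (Polynomial.aeval (MvPolynomial.X i : (MvPolynomial (Fin d) (ZMod p))) (auxbin (ZMod p) k)) • (M i k).map MvPolynomial.C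
  let f : Matrix (Fin n) (Fin n) (MvPolynomial (Fin d) (ZMod p)) := ((List.finRange d).map A).prod
  let y : Fin d → (MvPolynomial (Fin d) (ZMod p)) := fun j => ∑ a, ∑ b, MvPolynomial.C (l j (Matrix.single a b 1)) *
    (f a b - (1 : Matrix (Fin n) (Fin n) (MvPolynomial (Fin d) (ZMod p))) a b)
  -- evaluation
  have hev : ∀ t : Fin d → (ZMod p), ∃ x : G, f.map (MvPolynomial.eval t) = ((x : SL n (ZMod p)) : Matrix (Fin n) (Fin n) (ZMod p)) := by
    intro t
    have h1 : ∀ i, ∃ x ∈ G, (MvPolynomial.eval t).mapMatrix (A i) = (x : Matrix (Fin n) (Fin n) (ZMod p)) := by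
      intro i
      obtain ⟨x, hx, hxe⟩ := hMG i (t i).val
      refine ⟨x, hx, ?_⟩
      rw [hxe]
      ext a b
      simp only [A, map_sum, RingHom.mapMatrix_apply, Matrix.sum_apply, Matrix.map_apply,
        Matrix.smul_apply, smul_eq_mul, map_mul, MvPolynomial.eval_C]
      apply Finset.sum_congr rfl
      intro k hk
      congr 1
      rw [← auxbin_eval p k ((Finset.mem_range.1 hk).trans hnp), ZMod.natCast_zmod_val]
      have := Polynomial.hom_eval₂ (auxbin (ZMod p) k) (algebraMap (ZMod p) (MvPolynomial (Fin d) (ZMod p))) (MvPolynomial.eval t) (MvPolynomial.X i)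
      rw [Polynomial.aeval_def, this, MvPolynomial.eval_X, MvPolynomial.algebraMap_eq]
      have h2 : (MvPolynomial.eval t).comp (MvPolynomial.C) = RingHom.id (ZMod p) := by
        ext; simp
      rw [h2, Polynomial.eval₂_id]
    choose x hx hxe using h1
    refine ⟨⟨((List.finRange d).map x).prod, Subgroup.list_prod_mem _ ?_⟩, ?_⟩
    · intro z hz
      obtain ⟨i, -, rfl⟩ := List.mem_map.1 hz
      exact hx i
    · have h2 := map_list_prod (MvPolynomial.eval t).mapMatrix ((List.finRange d).map A)
      have h3 : ∀ l : List (Fin d), (((l.map x).prod : SL n (ZMod p)) : Matrix (Fin n) (Fin n) (ZMod p))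
          = (l.map fun i => (x i : Matrix (Fin n) (Fin n) (ZMod p))).prod := by
        intro l
        induction l with
        | nil => simp
        | cons i l ih => simp [ih]
      rw [h3]
      refine h2.trans ?_
      rw [List.map_map]
      congr 1
      apply List.map_congr_left
      intro i _
      exact hxe i
  choose ev hev using hev
  refine auxH_count p d (d * n) D hD ev
    (fun j x => l j (((x : SL n (ZMod p)) : Matrix (Fin n) (Fin n) (ZMod p)) - 1)) y ?_ ?_ ?_
  · intro j t
    rw [auxH_lin, ← hev]
    simp only [y, map_sum, map_mul, MvPolynomial.eval_C, map_sub, Matrix.sub_apply, Matrix.map_apply]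
    refine Finset.sum_congr rfl fun a _ => Finset.sum_congr rfl fun b _ => ?_
    congr 2
    rw [Matrix.one_apply, Matrix.one_apply]
    split_ifs <;> simp
  · intro j
    have hA : ∀ i a b, (A i a b).totalDegree ≤ n := by
      intro i a b
      simp only [A, Matrix.sum_apply, Matrix.map_apply, Matrix.smul_apply, smul_eq_mul]
      apply MvPolynomial.totalDegree_finsetSum_le
      intro k hk
      refine (MvPolynomial.totalDegree_mul _ _).trans ?_
      rw [MvPolynomial.totalDegree_C, add_zero]
      exact (auxH_aeval_deg i _).trans ((auxbin_deg _ k).trans (Finset.mem_range.1 hk).le)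
    have hf := auxH_list_deg ((List.finRange d).map A) (e := n) (by
      intro B hB
      obtain ⟨i, -, rfl⟩ := List.mem_map.1 hB
      exact hA i)
    rw [List.length_map, List.length_finRange] at hf
    simp only [y]
    apply MvPolynomial.totalDegree_finsetSum_le
    intro a _
    apply MvPolynomial.totalDegree_finsetSum_le
    intro b _
    refine (MvPolynomial.totalDegree_mul _ _).trans ?_
    rw [MvPolynomial.totalDegree_C, zero_add]
    refine (MvPolynomial.totalDegree_sub _ _).trans (max_le (hf a b) ?_)
    rw [Matrix.one_apply]
    split_ifs <;> simp
  · intro j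
    let π := Ideal.Quotient.mk (I ^ 2)
    let x : Fin d → (MvPolynomial (Fin d) (ZMod p)) ⧸ (I ^ 2) := fun i => π (MvPolynomial.X i)
    have hx : ∀ i j, x i * x j = 0 := by
      intro i j
      simp only [x]
      rw [← map_mul]
      refine Ideal.Quotient.eq_zero_iff_mem.2 ?_
      rw [sq]
      exact Ideal.mul_mem_mul (Ideal.subset_span ⟨i, rfl⟩) (Ideal.subset_span ⟨j, rfl⟩)
    let κ : ZMod p →+* (MvPolynomial (Fin d) (ZMod p)) ⧸ (I ^ 2) := π.comp MvPolynomial.C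
    have hA : ∀ i, π.mapMatrix (A i) = 1 + x i • (N i).map κ := by
      intro i
      have hk : ∀ k ∈ Finset.range n, π (Polynomial.aeval (MvPolynomial.X i) (auxbin (ZMod p) k))
          = (if k = 0 then 1 else 0) + x i * κ ((auxbin (ZMod p) k).coeff 1) := by
        intro k hk
        have h1 := Ideal.Quotient.eq.2 (auxH_aeval_ord i (auxbin (ZMod p) k))
        have h0 : (auxbin (ZMod p) k).coeff 0 = if k = 0 then 1 else 0 := by
          rw [Polynomial.coeff_zero_eq_eval_zero]
          have := auxbin_eval p k ((Finset.mem_range.1 hk).trans hnp) 0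
          rw [Nat.cast_zero] at this
          rw [this]
          cases k <;> simp
        rw [h0] at h1
        refine h1.trans ?_
        rw [map_add, map_mul, mul_comm]
        congr 1
        split_ifs <;> simp
      ext a b
      simp only [A, RingHom.mapMatrix_apply, Matrix.map_apply, Matrix.sum_apply, Matrix.smul_apply,
        map_sum, smul_eq_mul, map_mul, Matrix.add_apply, hN]
      rw [Finset.mul_sum]
      have h1 : (1 : Matrix (Fin n) (Fin n) ((MvPolynomial (Fin d) (ZMod p)) ⧸ (I ^ 2))) a b
          = ∑ k ∈ Finset.range n, (if k = 0 then 1 else 0) * κ (M i k a b) := by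
        rw [Finset.sum_eq_single 0]
        · rw [hM0, if_pos rfl, one_mul, Matrix.one_apply, Matrix.one_apply]
          split_ifs <;> simp
        · intro k _ hk; simp [hk]
        · intro h; exact absurd (Finset.mem_range.2 hn) h
      rw [h1, ← Finset.sum_add_distrib]
      apply Finset.sum_congr rfl
      intro k hk'
      rw [hk k hk']
      simp only [κ, RingHom.comp_apply]
      ring
    have hf : π.mapMatrix f = 1 + ∑ i, x i • (N i).map κ := by
      have h2 := map_list_prod π.mapMatrix ((List.finRange d).map A)
      refine h2.trans ?_
      rw [List.map_map]
      have h3 : (⇑π.mapMatrix ∘ A) = fun i => 1 + x i • (N i).map κ := funext hA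
      rw [h3, auxH_list_ord x hx]
      congr 1
    apply Ideal.Quotient.eq.1
    change π (y j) = x j
    have hfa : ∀ a b, π (f a b - (1 : Matrix (Fin n) (Fin n) (MvPolynomial (Fin d) (ZMod p))) a b)
        = ∑ i, x i * κ (N i a b) := by
      intro a b
      have h1 := congrFun (congrFun hf a) b
      rw [RingHom.mapMatrix_apply, Matrix.map_apply, Matrix.add_apply, Matrix.sum_apply] at h1
      rw [map_sub, h1]
      have : π ((1 : Matrix (Fin n) (Fin n) (MvPolynomial (Fin d) (ZMod p))) a b) = (1 : Matrix (Fin n) (Fin n) ((MvPolynomial (Fin d) (ZMod p)) ⧸ (I ^ 2))) a b := by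
        rw [Matrix.one_apply, Matrix.one_apply]
        split_ifs <;> simp
      rw [this, add_sub_cancel_left]
      simp
    have hlx : ∀ i, κ (l j (N i)) = ∑ a, ∑ b, κ (l j (Matrix.single a b 1)) * κ (N i a b) := by
      intro i
      rw [auxH_lin]
      simp only [map_sum, map_mul]
    calc π (y j) = ∑ a, ∑ b, κ (l j (Matrix.single a b 1)) * ∑ i, x i * κ (N i a b) := by
          simp only [y, map_sum, map_mul, hfa]
          rfl
      _ = ∑ i, x i * κ (l j (N i)) := by
          simp only [hlx, Finset.mul_sum]
          symm
          rw [Finset.sum_comm]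
          refine Finset.sum_congr rfl fun a _ => ?_
          rw [Finset.sum_comm]
          refine Finset.sum_congr rfl fun b _ => Finset.sum_congr rfl fun i _ => ?_
          ring
      _ = x j := by simp [hl]

end PartH2


section PartJ

theorem auxJ_binom {R : Type*} [Ring R] (u : R) (n : ℕ) (hu : (u - 1) ^ n = 0) (m : ℕ) :
    u ^ m = ∑ k ∈ Finset.range n, (m.choose k : R) * (u - 1) ^ k := by
  have h1 : u ^ m = ∑ k ∈ Finset.range (m + 1), (m.choose k : R) * (u - 1) ^ k := by
    conv_lhs => rw [show u = (u - 1) + 1 by abel]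
    rw [(Commute.one_right (u - 1)).add_pow]
    refine Finset.sum_congr rfl fun k _ => ?_
    rw [one_pow, mul_one, (Nat.cast_commute _ _).eq]
  rw [h1]
  have h2 : ∑ k ∈ Finset.range (m + 1), (m.choose k : R) * (u - 1) ^ k
      = ∑ k ∈ Finset.range (n + (m + 1)), (m.choose k : R) * (u - 1) ^ k := by
    apply Finset.sum_subset
    · intro k hk; rw [Finset.mem_range] at *; omega
    · intro k _ hk
      rw [Finset.mem_range] at hk
      rw [Nat.choose_eq_zero_of_lt (by omega)]; simp
  have h3 : ∑ k ∈ Finset.range n, (m.choose k : R) * (u - 1) ^ k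
      = ∑ k ∈ Finset.range (n + (m + 1)), (m.choose k : R) * (u - 1) ^ k := by
    apply Finset.sum_subset
    · intro k hk; rw [Finset.mem_range] at *; omega
    · intro k _ hk
      rw [Finset.mem_range] at hk
      rw [pow_eq_zero_of_le (by omega) hu]; simp
  rw [h2, h3]

theorem auxJ_log {p n : ℕ} [Fact p.Prime] (hn : 2 ≤ n) (w : Matrix (Fin n) (Fin n) (ZMod p))
    (hw : w ^ n = 0) (hw0 : w ≠ 0) (z : ZMod p) :
    ∑ k ∈ Finset.range n, (auxbin (ZMod p) k).coeff 1 • w ^ k ≠ z • 1 := by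
  obtain ⟨n', hn'⟩ := Nat.exists_eq_add_of_le' hn
  intro hz
  have h0 : (auxbin (ZMod p) 0).coeff 1 = 0 := by simp [auxbin, Polynomial.coeff_one]
  have h1 : (auxbin (ZMod p) 1).coeff 1 = 1 := by simp [auxbin]
  set q := ∑ k ∈ Finset.range n', (auxbin (ZMod p) (k + 2)).coeff 1 • w ^ k with hq
  have hN : ∑ k ∈ Finset.range n, (auxbin (ZMod p) k).coeff 1 • w ^ k = w * (1 + w * q) := by
    suffices gen : ∀ m, m = n' + 2 → ∑ k ∈ Finset.range m, (auxbin (ZMod p) k).coeff 1 • w ^ k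
        = w * (1 + w * q) from gen n hn'
    intro m hm
    rw [hm, Finset.sum_range_succ', Finset.sum_range_succ', h0, zero_add, h1, hq, mul_add, mul_one,
      Finset.mul_sum, Finset.mul_sum]
    simp only [zero_smul, add_zero, one_smul, pow_one, add_assoc]
    rw [add_comm]
    congr 1
    refine Finset.sum_congr rfl fun k _ => ?_
    rw [mul_smul_comm, mul_smul_comm, ← pow_succ', ← pow_succ', add_assoc]
  have hwq : Commute w q := by
    rw [hq]
    exact Commute.sum_right _ _ _ fun k _ => ((Commute.refl w).pow_right k).smul_right _
  have hwv : Commute w (1 + w * q) :=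
    (Commute.one_right w).add_right ((Commute.refl w).mul_right hwq)
  have hnil : IsNilpotent (w * q) := ⟨n, by rw [hwq.mul_pow, hw, zero_mul]⟩
  have hunit : IsUnit (1 + w * q) := hnil.isUnit_one_add
  rw [hN] at hz
  have h2 : (w * (1 + w * q)) ^ n = 0 := by rw [hwv.mul_pow, hw, zero_mul]
  have : Nonempty (Fin n) := ⟨⟨0, by omega⟩⟩
  rw [hz, smul_pow, one_pow, smul_eq_zero] at h2
  have h3 : z = 0 := by
    rcases h2 with h2 | h2
    · exact pow_eq_zero_iff (by omega) |>.1 h2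
    · exact absurd h2 one_ne_zero
  rw [h3, zero_smul] at hz
  exact hw0 (hunit.mul_left_eq_zero.1 hz)

theorem auxJ_modp (n p D : ℕ) (hn : 2 ≤ n) (hp : p.Prime) (hnp : n < p)
    (hD : (n ^ 2 - 1) * D * ((n ^ 2 - 1) * n) < p) (G : Subgroup (SL n (ZMod p)))
    (hG : p ∣ Nat.card G)
    (hW : ∀ W : Submodule (ZMod p) (Matrix (Fin n) (Fin n) (ZMod p)),
      (∀ g ∈ G, ∀ c ∈ W,
      (g : Matrix (Fin n) (Fin n) (ZMod p)) * c * ((g⁻¹ : SL n (ZMod p)) : Matrix _ _ _) ∈ W) →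
      ∀ a b c, c ∈ W → Matrix.single a b 1 * c - c * Matrix.single a b 1 ∈ W) :
    D ^ (n ^ 2 - 1) ≤ Nat.card G := by
  have : Fact p.Prime := ⟨hp⟩
  have hne : Nonempty (Fin n) := ⟨⟨0, by omega⟩⟩
  obtain ⟨u, hu⟩ := exists_prime_orderOf_dvd_card' p hG
  set U : Matrix (Fin n) (Fin n) (ZMod p) := ((u : SL n (ZMod p)) : Matrix (Fin n) (Fin n) (ZMod p)) with hU
  have hUp : ∀ m : ℕ, ((((u : SL n (ZMod p))) ^ m : SL n (ZMod p)) : Matrix (Fin n) (Fin n) (ZMod p)) = U ^ m := by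
    intro m; rw [Matrix.SpecialLinearGroup.coe_pow]
  set w := U - 1 with hw
  have hwp : w ^ p = 0 := by
    rw [hw, sub_pow_char_of_commute _ (Commute.one_right U), one_pow, ← hUp]
    have : (u : SL n (ZMod p)) ^ p = 1 := by
      have := pow_orderOf_eq_one u
      rw [hu] at this
      exact_mod_cast congrArg Subtype.val this
    rw [this]; simp
  have hwn : w ^ n = 0 := by
    have h1 : IsNilpotent w := ⟨p, hwp⟩
    have h2 := (Matrix.isNilpotent_charpoly_sub_pow_of_isNilpotent h1).eq_zero
    have h3 := Matrix.aeval_self_charpoly w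
    rw [sub_eq_zero.1 h2] at h3
    simpa using h3
  have hw0 : w ≠ 0 := by
    intro h
    have h1 : U = 1 := sub_eq_zero.1 h
    have h2 : u = 1 := Subtype.ext (Subtype.ext h1)
    rw [h2, orderOf_one] at hu
    exact hp.one_lt.ne hu
  set N := ∑ k ∈ Finset.range n, (auxbin (ZMod p) k).coeff 1 • w ^ k with hN
  let cj : SL n (ZMod p) → Matrix (Fin n) (Fin n) (ZMod p) → Matrix (Fin n) (Fin n) (ZMod p) :=
    fun g c => (g : Matrix (Fin n) (Fin n) (ZMod p)) * c * ((g⁻¹ : SL n (ZMod p)) : Matrix _ _ _)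
  have hinv : ∀ g : SL n (ZMod p), (g : Matrix (Fin n) (Fin n) (ZMod p)) * ((g⁻¹ : SL n (ZMod p)) : Matrix _ _ _) = 1 := by
    intro g
    rw [← Matrix.SpecialLinearGroup.coe_mul, mul_inv_cancel, Matrix.SpecialLinearGroup.coe_one]
  let s : Set (Matrix (Fin n) (Fin n) (ZMod p)) := {c | ∃ g ∈ G, cj g N = c}
  have hinvW : ∀ g ∈ G, ∀ c ∈ Submodule.span (ZMod p) s,
      (g : Matrix (Fin n) (Fin n) (ZMod p)) * c * ((g⁻¹ : SL n (ZMod p)) : Matrix _ _ _)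
        ∈ Submodule.span (ZMod p) s := by
    intro g hg c hc
    induction hc using Submodule.span_induction with
    | mem c hc =>
      obtain ⟨x, hx, rfl⟩ := hc
      refine Submodule.subset_span ⟨g * x, G.mul_mem hg hx, ?_⟩
      simp only [cj, _root_.mul_inv_rev, Matrix.SpecialLinearGroup.coe_mul, Matrix.mul_assoc]
    | zero => simp
    | add a b _ _ ha hb => rw [Matrix.mul_add, Matrix.add_mul]; exact Submodule.add_mem _ ha hb
    | smul r a _ ha => rw [Matrix.mul_smul, Matrix.smul_mul]; exact Submodule.smul_mem _ _ ha
  have h2 : (2 : ZMod p) ≠ 0 := by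
    have : ((2 : ℕ) : ZMod p) ≠ 0 := by
      rw [Ne, ZMod.natCast_eq_zero_iff]
      intro h
      have := Nat.le_of_dvd (by norm_num) h
      omega
    exact_mod_cast this
  have hrank : n ^ 2 - 1 ≤ Module.finrank (ZMod p) (Submodule.span (ZMod p) s) := by
    apply auxK_rank
    refine auxK_main h2 _ (hW _ hinvW) N (Submodule.subset_span ⟨1, G.one_mem, ?_⟩)
      (auxJ_log hn w hwn hw0)
    simp [cj]
  obtain ⟨f, hfs, -, hli⟩ := Submodule.exists_fun_fin_finrank_span_eq (ZMod p) s
  choose g hg hgf using hfs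
  have hsum : ∀ (x : SL n (ZMod p)) (c : ℕ → ZMod p), ∑ k ∈ Finset.range n, c k • cj x (w ^ k)
      = cj x (∑ k ∈ Finset.range n, c k • w ^ k) := by
    intro x c
    simp only [cj]
    rw [Matrix.mul_sum, Matrix.sum_mul]
    refine Finset.sum_congr rfl fun k _ => ?_
    rw [Matrix.mul_smul, Matrix.smul_mul]
  refine auxH_build n p (n ^ 2 - 1) D (by omega) hnp hD G
    (fun i k => cj (g (Fin.castLE hrank i)) (w ^ k)) ?_ ?_ ?_
  · intro i
    simp only [cj, pow_zero, Matrix.mul_one, hinv]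
  · intro i m
    refine ⟨g (Fin.castLE hrank i) * (u : SL n (ZMod p)) ^ m * (g (Fin.castLE hrank i))⁻¹,
      G.mul_mem (G.mul_mem (hg _) (G.pow_mem u.2 m)) (G.inv_mem (hg _)), ?_⟩
    rw [hsum, Matrix.SpecialLinearGroup.coe_mul, Matrix.SpecialLinearGroup.coe_mul, hUp,
      auxJ_binom U n hwn m]
    simp only [cj]
    congr 2
    refine Finset.sum_congr rfl fun k _ => ?_
    rw [← nsmul_eq_mul, Nat.cast_smul_eq_nsmul]
  · have h3 := hli.comp (Fin.castLE hrank) (Fin.castLE_injective hrank)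
    convert h3 using 1
    · funext i
      rw [hsum]
      exact hgf _
    · rfl

theorem auxJ_top (n : ℕ) (hn : n.Prime) (hodd : Odd n) (H : Subgroup (SL n ℤ)) (h : SL n ℤ)
    (hh : h ∈ H) (hirr : Irreducible (matQ h).charpoly) (hns : ¬ SolvableByFinite H) :
    ∃ B : ℕ, ∀ p : ℕ, p.Prime → B < p → H.map (redMod n p) = ⊤ := by
  obtain ⟨B1, hB1⟩ := auxS_order n hn hodd H h hh hirr hns
  obtain ⟨B2, hB2⟩ := auxG_final n hn hodd H h hh hirr hns
  set d := n ^ 2 - 1 with hd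
  set E := d * (d * n) + 1 with hE
  refine ⟨B1 + B2 + n + E + 2 * (2 * E) ^ d, fun p hp hBp => ?_⟩
  have : Fact p.Prime := ⟨hp⟩
  set D := p / E with hDdef
  have hDE : E * D ≤ p := Nat.mul_div_le p E
  have hD1 : 0 < D := Nat.div_pos (by omega) (by omega)
  have hDlt : p < E * D + E := by
    have := Nat.lt_mul_div_succ p (show 0 < E by omega)
    rwa [mul_add, mul_one] at this
  have hD2 : p ≤ 2 * E * D := by
    have : E * 1 ≤ E * D := Nat.mul_le_mul_left E hD1
    have e : 2 * E * D = E * D + E * D := by ring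
    omega
  have hD : d * D * (d * n) < p := by
    have e : E * D = d * D * (d * n) + D := by rw [hE]; ring
    omega
  set G := H.map (redMod n p) with hG
  have hcard := auxJ_modp n p D hn.two_le hp (by omega) hD G (hB1 p hp (by omega))
    (hB2 p hp (by omega))
  rw [← hd] at hcard
  have hpd : p ^ d ≤ (2 * E) ^ d * Nat.card G := by
    calc p ^ d ≤ (2 * E * D) ^ d := Nat.pow_le_pow_left hD2 d
      _ = (2 * E) ^ d * D ^ d := by rw [mul_pow]
      _ ≤ _ := Nat.mul_le_mul_left _ hcard
  have hSL := auxK_card n p hn.pos hp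
  have hn2 : n ^ 2 = d + 1 := by
    have : 0 < n ^ 2 := pow_pos hn.pos 2
    omega
  rw [hn2, pow_succ] at hSL
  have hidx := G.card_mul_index
  have hGpos : 0 < Nat.card G := Nat.card_pos
  refine auxA_index hn.pos hp G ?_ ?_
  · exact Subgroup.index_ne_zero_of_finite
  · have h1 : Nat.card (SL n (ZMod p)) ≤ 2 * p ^ d := by
      have hp1 : p ≤ 2 * (p - 1) := by have := hp.two_le; omega
      have h3 : Nat.card (SL n (ZMod p)) * (p - 1) ≤ (2 * p ^ d) * (p - 1) := by
        calc _ ≤ p ^ d * p := hSL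
          _ ≤ p ^ d * (2 * (p - 1)) := Nat.mul_le_mul_left _ hp1
          _ = _ := by ring
      exact Nat.le_of_mul_le_mul_right h3 (by have := hp.two_le; omega)
    have h2 : Nat.card G * G.index ≤ Nat.card G * (2 * (2 * E) ^ d) := by
      rw [hidx]
      calc _ ≤ 2 * p ^ d := h1
        _ ≤ 2 * ((2 * E) ^ d * Nat.card G) := Nat.mul_le_mul_left _ hpd
        _ = _ := by ring
    have := Nat.le_of_mul_le_mul_left h2 hGpos
    omega

end PartJ


/-- For odd prime `n` and finitely generated `H ≤ SL(n,ℤ)`: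
`φ_p(H) = SL(n,ℤ/pℤ)` for all but finitely many primes `p` iff `H` contains an element
with irreducible characteristic polynomial and is not solvable-by-finite. -/
theorem dense_iff_irreducible_element (n : ℕ) (hn : n.Prime) (hodd : Odd n)
    (H : Subgroup (SL n ℤ)) (hFG : H.FG) :
    {p : ℕ | p.Prime ∧ H.map (redMod n p) ≠ ⊤}.Finite ↔
      ((∃ h ∈ H, Irreducible (matQ h).charpoly) ∧ ¬ SolvableByFinite H) := by
  constructor
  · intro hfin
    exact auxB_forward n hn hodd H hfin
  · rintro ⟨⟨h, hh, hirr⟩, hns⟩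
    obtain ⟨B, hB⟩ := auxJ_top n hn hodd H h hh hirr hns
    apply (Set.finite_Iic B).subset
    rintro p ⟨hp, hne⟩
    by_contra hlt
    exact hne (hB p hp (by simpa using hlt))
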